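/- arXiv:1907.02914 — 2 statements merged into one kernel-verified Lean document; each statement's English description precedes it below -/
import Mathlib

section
/- Let K be a number field. There is a constant C = C(K) > 0 such that for X ≥ 1, Σ_{2 ≤ N(a) ≤ X} Q(a) = c_K·X + O(X·exp(−C(log X)^{1/3})), where Q(a) counts the prime ideals p ⊇ a of norm equal to the maximal norm M(a) among primes containing a. -/
open NumberField Ideal Filter

noncomputable section

namespace AlladiGen

variable (K : Type*) [Field K] [NumberField K]

open Classical in
/-- The generalized Möbius function on integral ideals. -/
def muK (a : Ideal (𝓞 K)) : ℤ :=
  if Squarefree a then (-1) ^ (Nat.card {p : Ideal (𝓞 K) // p.IsPrime ∧ a ≤ p}) else 0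

/-- `p` is a prime ideal of minimal norm among those containing `a`. -/
def MinimalPrime (a p : Ideal (𝓞 K)) : Prop :=
  p.IsPrime ∧ a ≤ p ∧ ∀ q : Ideal (𝓞 K), q.IsPrime → a ≤ q → absNorm p ≤ absNorm q

/-- `a ∈ D(K,S)`: `a` is distinguishable with minimal prime in `S`. -/
def InD (S : Set (Ideal (𝓞 K))) (a : Ideal (𝓞 K)) : Prop :=
  ∃ p : Ideal (𝓞 K), MinimalPrime K a p ∧ p ∈ S ∧ ∀ q : Ideal (𝓞 K), MinimalPrime K a q → q = p

/-- `π_S(K; X)`: number of prime ideals in `S` of norm at most `X`. -/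
def primeCount (S : Set (Ideal (𝓞 K))) (X : ℝ) : ℕ :=
  Nat.card {p : Ideal (𝓞 K) // p.IsPrime ∧ p ∈ S ∧ (absNorm p : ℝ) ≤ X}

/-- `S` has natural density `δ` within the prime ideals of `K`. -/
def HasPrimeDensity (S : Set (Ideal (𝓞 K))) (δ : ℝ) : Prop :=
  Tendsto (fun X : ℝ => (primeCount K S X : ℝ) / (primeCount K Set.univ X : ℝ))
    atTop (nhds δ)

/-- `M(a)`: the maximal norm of a prime ideal containing `a`. -/
def maxNorm (a : Ideal (𝓞 K)) : ℕ :=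
  sSup (absNorm '' {p : Ideal (𝓞 K) | p.IsPrime ∧ a ≤ p})

/-- `Q_S(a)`: number of primes in `S` containing `a` of maximal norm. -/
def QS (S : Set (Ideal (𝓞 K))) (a : Ideal (𝓞 K)) : ℕ :=
  Nat.card {p : Ideal (𝓞 K) // p.IsPrime ∧ a ≤ p ∧ p ∈ S ∧ absNorm p = maxNorm K a}

/-- `c_K`: residue of the Dedekind zeta function at 1, via the analytic class number formula. -/
def cK : ℝ :=
  (2 ^ (InfinitePlace.nrRealPlaces K) * (2 * Real.pi) ^ (InfinitePlace.nrComplexPlaces K) *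
    NumberField.Units.regulator K * (NumberField.classNumber K)) /
  ((NumberField.Units.torsionOrder K : ℝ) * Real.sqrt |(NumberField.discr K : ℝ)|)

/-- `Ψ(X,Y)`: number of `Y`-smooth nonzero integral ideals of norm at most `X`. -/
def Psi (X Y : ℝ) : ℕ :=
  Nat.card {a : Ideal (𝓞 K) // a ≠ ⊥ ∧ (absNorm a : ℝ) ≤ X ∧
    ∀ p : Ideal (𝓞 K), p.IsPrime → a ≤ p → (absNorm p : ℝ) ≤ Y}

/-- `[X]_K`: number of nonzero integral ideals of norm at most `X`. -/
def idealCount (X : ℝ) : ℕ := Nat.card {a : Ideal (𝓞 K) // a ≠ ⊥ ∧ (absNorm a : ℝ) ≤ X}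

/-- The logarithmic integral `Li(X) = ∫_2^X dt / log t`. -/
def Li (X : ℝ) : ℝ := ∫ t in (2:ℝ)..X, 1 / Real.log t

section volumes

open NumberField.InfinitePlace NumberField.mixedEmbedding NumberField.mixedEmbedding.fundamentalCone
open MeasureTheory ENNReal NumberField.Units NumberField.Units.dirichletUnitTheorem
open scoped Real


open scoped Classical in
theorem volume_expMapBasis_le : ∃ C : ℝ, 0 ≤ C ∧ ∀ T : Set (realSpace K), MeasurableSet T →
    (∀ u ∈ T, u w₀ ≤ 1) →
    volume (normAtAllPlaces ⁻¹' (expMapBasis '' T)) ≤ ENNReal.ofReal C * volume T := by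
  have h2 : (2 ^ nrRealPlaces K * .ofReal (2 * π) ^ nrComplexPlaces K *
      ((2 : ℝ≥0∞)⁻¹ ^ nrComplexPlaces K * ENNReal.ofReal (regulator K) * (Module.finrank ℚ K)) *
      ENNReal.ofReal (Real.exp (Module.finrank ℚ K))) ≠ ⊤ := by
    finiteness
  refine ⟨(2 ^ nrRealPlaces K * .ofReal (2 * π) ^ nrComplexPlaces K *
      ((2 : ℝ≥0∞)⁻¹ ^ nrComplexPlaces K * ENNReal.ofReal (regulator K) * (Module.finrank ℚ K)) *
      ENNReal.ofReal (Real.exp (Module.finrank ℚ K))).toReal, ENNReal.toReal_nonneg, ?_⟩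
  intro T hT hT1
  rw [ENNReal.ofReal_toReal h2]
  have hm : MeasurableSet (normAtAllPlaces ⁻¹' (expMapBasis '' T)) := by
    refine MeasurableSet.preimage ?_ (continuous_normAtAllPlaces K).measurable
    exact MeasurableSet.image_of_continuousOn_injOn hT (continuous_expMapBasis K).continuousOn
      (injective_expMapBasis K).injOn
  rw [volume_eq_two_pow_mul_two_pi_pow_mul_integral Set.preimage_image_preimage hm,
    normAtAllPlaces_image_preimage_expMapBasis,
    setLIntegral_expMapBasis_image hT (by fun_prop)]
  simp_rw [ENNReal.inv_mul_cancel_right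
    (Finset.prod_ne_zero_iff.mpr fun _ _ ↦ ofReal_ne_zero_iff.mpr (expMapBasis_pos _ _))
    (prod_ne_top fun _ _ ↦ ofReal_ne_top)]
  rw [← mul_assoc (2 ^ nrRealPlaces K * ENNReal.ofReal (2 * π) ^ nrComplexPlaces K),
    mul_assoc _ _ (volume T)]
  gcongr
  calc _ ≤ ∫⁻ _ in T, ENNReal.ofReal (Real.exp (Module.finrank ℚ K)) := by
        refine setLIntegral_mono (by fun_prop) fun u hu => ?_
        gcongr
        have := hT1 u hu
        have h0 : (0 : ℝ) ≤ Module.finrank ℚ K := by positivity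
        nlinarith
    _ = _ := by simp

open scoped Classical in
theorem volume_box_le (R : ℝ) : ∃ C : ℝ, 0 ≤ C ∧ ∀ T : Set (realSpace K), MeasurableSet T →
    (∀ u ∈ T, ∀ w, 0 ≤ u w ∧ u w ≤ R) →
    volume (normAtAllPlaces ⁻¹' T) ≤ ENNReal.ofReal C * volume T := by
  have h2 : (2 ^ nrRealPlaces K * .ofReal (2 * π) ^ nrComplexPlaces K *
      ∏ w : {w : InfinitePlace K // IsComplex w}, ENNReal.ofReal R) ≠ ⊤ := by
    have : ∏ w : {w : InfinitePlace K // IsComplex w}, ENNReal.ofReal R ≠ ⊤ :=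
      prod_ne_top fun _ _ ↦ ofReal_ne_top
    finiteness
  refine ⟨(2 ^ nrRealPlaces K * .ofReal (2 * π) ^ nrComplexPlaces K *
      ∏ w : {w : InfinitePlace K // IsComplex w}, ENNReal.ofReal R).toReal,
      ENNReal.toReal_nonneg, fun T hT h => ?_⟩
  rw [ENNReal.ofReal_toReal h2]
  have hm : MeasurableSet (normAtAllPlaces ⁻¹' T : Set (mixedSpace K)) :=
    MeasurableSet.preimage hT (continuous_normAtAllPlaces K).measurable
  rw [volume_eq_two_pow_mul_two_pi_pow_mul_integral Set.preimage_image_preimage hm,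
    normAtAllPlaces_image_preimage_of_nonneg (fun x a w ↦ (h x a w).1), mul_assoc _ _ (volume T)]
  gcongr
  calc _ ≤ ∫⁻ _ in T, ∏ w : {w : InfinitePlace K // IsComplex w}, ENNReal.ofReal R := by
        refine setLIntegral_mono (by fun_prop) fun u hu => ?_
        refine Finset.prod_le_prod' fun w _ => ?_
        gcongr
        exact (h u hu _).2
    _ = _ := by rw [setLIntegral_const]


open scoped Classical in
theorem normAtPlace_le_norm' (x : mixedSpace K) (w : InfinitePlace K) :
    normAtPlace w x ≤ ‖x‖ := by
  rw [norm_eq_sup'_normAtPlace]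
  exact Finset.le_sup' (fun w => normAtPlace w x) (Finset.mem_univ w)

open scoped Classical in
theorem abs_normAtPlace_sub_le (x y : mixedSpace K) (w : InfinitePlace K) :
    |normAtPlace w x - normAtPlace w y| ≤ ‖x - y‖ := by
  have h1 := normAtPlace_add_le w (x - y) y
  have h2 := normAtPlace_add_le w (y - x) x
  have h3 := normAtPlace_le_norm' K (x - y) w
  have h4 := normAtPlace_le_norm' K (y - x) w
  rw [norm_sub_rev] at h4
  simp only [sub_add_cancel] at h1 h2
  rw [abs_le]
  constructor <;> linarith

theorem abs_log_sub_le {a b η δ : ℝ} (hη : 0 < η) (ha : η ≤ a) (hab : |a - b| ≤ δ)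
    (hδ : δ ≤ η / 2) : |Real.log a - Real.log b| ≤ 2 * δ / η := by
  have hab' := abs_le.1 hab
  have hb : η / 2 ≤ b := by linarith
  have hb0 : 0 < b := by linarith
  have ha0 : 0 < a := by linarith
  have h1 : Real.log a - Real.log b ≤ 2 * δ / η := by
    rw [← Real.log_div ha0.ne' hb0.ne']
    refine (Real.log_le_sub_one_of_pos (by positivity)).trans ?_
    rw [div_sub_one hb0.ne', div_le_div_iff₀ hb0 hη]
    nlinarith
  have h2 : Real.log b - Real.log a ≤ 2 * δ / η := by
    rw [← Real.log_div hb0.ne' ha0.ne']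
    refine (Real.log_le_sub_one_of_pos (by positivity)).trans ?_
    rw [div_sub_one ha0.ne', div_le_div_iff₀ ha0 hη]
    nlinarith
  rw [abs_le]
  constructor <;> linarith

/-- The box around a face of the parameter set. -/
def faceBox (κ η : ℝ) (i : InfinitePlace K) (c : ℝ) : Set (realSpace K) :=
  open scoped Classical in
  (Set.univ.pi fun v ↦ if v = i then Set.Icc (c - κ) (c + κ) else
    if v = w₀ then Set.Icc (-(1 / η)) 1 else Set.Icc (-1) 2) ∩ {u | u w₀ ≤ 1}

theorem measurableSet_faceBox (κ η : ℝ) (i : InfinitePlace K) (c : ℝ) :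
    MeasurableSet (faceBox K κ η i c) := by
  classical
  refine MeasurableSet.inter (MeasurableSet.univ_pi fun _ ↦ ?_) ?_
  · split_ifs <;> exact measurableSet_Icc
  · exact measurableSet_le (by fun_prop) (by fun_prop)

theorem volume_faceBox_le {κ η : ℝ} (hη : 0 < η) (hη1 : η ≤ 1)
    (i : InfinitePlace K) (c : ℝ) :
    volume (faceBox K κ η i c) ≤ ENNReal.ofReal (2 * κ) *
      (3 ^ (Fintype.card (InfinitePlace K)) * ENNReal.ofReal (1 / η)) := by
  classical
  have h1η : 1 ≤ 1 / η := by rw [le_div_iff₀ hη]; linarith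
  refine (measure_mono Set.inter_subset_left).trans ?_
  rw [volume_pi_pi, ← Finset.mul_prod_erase Finset.univ _ (Finset.mem_univ i), if_pos rfl,
    Real.volume_Icc]
  have e1 : c + κ - (c - κ) = 2 * κ := by ring
  rw [e1]
  gcongr
  calc _ ≤ ∏ v ∈ Finset.univ.erase i, ((3 : ℝ≥0∞) *
        (if w₀ = v then ENNReal.ofReal (1 / η) else 1)) := by
        refine Finset.prod_le_prod' fun v hv => ?_
        rw [if_neg (Finset.ne_of_mem_erase hv)]
        by_cases h : v = w₀
        · rw [if_pos h, if_pos h.symm, Real.volume_Icc, ← ENNReal.ofReal_ofNat 3,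
            ← ENNReal.ofReal_mul (by norm_num)]
          gcongr
          linarith
        · rw [if_neg h, if_neg (Ne.symm h), Real.volume_Icc, mul_one, ← ENNReal.ofReal_ofNat 3]
          gcongr
          norm_num
    _ ≤ _ := by
        rw [Finset.prod_mul_distrib, Finset.prod_const, Finset.prod_ite_eq]
        gcongr
        · norm_num
        · exact Finset.card_le_univ _
        · split_ifs
          · exact le_rfl
          · rw [← ENNReal.ofReal_one]
            gcongr

theorem exists_mem_faceBox {κ η : ℝ} (hκ1 : κ ≤ 1) (u v : realSpace K)
    (huv : ∀ w, |u w - v w| ≤ κ) (hu : -(1 / η) ≤ u w₀)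
    (h : ¬ (u ∈ paramSet K ↔ v ∈ paramSet K)) :
    ∃ i : InfinitePlace K, u ∈ faceBox K κ η i 0 ∨ u ∈ faceBox K κ η i 1 := by
  classical
  have hw (w) := abs_le.1 (huv w)
  have key : ∀ w, (w = w₀ → u w ≤ 1) ∧ (w ≠ w₀ → -1 ≤ u w ∧ u w ≤ 2) := by
    have : u ∈ paramSet K ∨ v ∈ paramSet K := by tauto
    intro w
    have hww := hw w
    rcases this with h | h
    · have := h w trivial
      refine ⟨fun hw0 => ?_, fun hw0 => ?_⟩
      · simp only [hw0, if_true, Set.mem_Iic] at this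
        rw [hw0]; linarith
      · simp only [hw0, if_false, Set.mem_Ico] at this
        constructor <;> linarith
    · have := h w trivial
      refine ⟨fun hw0 => ?_, fun hw0 => ?_⟩
      · simp only [hw0, if_true, Set.mem_Iic] at this
        rw [hw0] at hww ⊢; linarith
      · simp only [hw0, if_false, Set.mem_Ico] at this
        constructor <;> linarith
  have key2 : ∃ i : InfinitePlace K, (|u i| ≤ κ ∨ |u i - 1| ≤ κ) := by
    by_contra! hcon
    apply h
    simp only [paramSet, Set.mem_univ_pi]
    refine forall_congr' fun w => ?_
    have h1 := (hcon w).1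
    have h2 := (hcon w).2
    have h3 := hw w
    rw [lt_abs] at h1 h2
    split_ifs with hw0
    · simp only [Set.mem_Iic]
      rcases h1 with h1 | h1
      · constructor <;> intro h <;> linarith
      · constructor <;> intro h <;> linarith
    · simp only [Set.mem_Ico]
      rcases h1 with h1 | h1 <;> rcases h2 with h2 | h2
      · constructor <;> rintro ⟨h, h'⟩ <;> constructor <;> linarith
      · constructor <;> rintro ⟨h, h'⟩ <;> constructor <;> linarith
      · constructor <;> rintro ⟨h, h'⟩ <;> constructor <;> linarith
      · constructor <;> rintro ⟨h, h'⟩ <;> constructor <;> linarith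
  obtain ⟨i, hi⟩ := key2
  refine ⟨i, ?_⟩
  have gen : ∀ c, |u i - c| ≤ κ → u ∈ faceBox K κ η i c := by
    intro c hc
    rw [abs_le] at hc
    refine ⟨?_, (key w₀).1 rfl⟩
    simp only [Set.mem_univ_pi]
    intro w
    split_ifs with h1 h2
    · subst h1; constructor <;> linarith
    · subst h2; exact ⟨hu, (key _).1 rfl⟩
    · exact (key w).2 h2
  rcases hi with hi | hi
  · exact Or.inl (gen 0 (by simpa using hi))
  · exact Or.inr (gen 1 hi)

/-- The box of vectors with one small coordinate. -/
def smallBox (R η : ℝ) (i : InfinitePlace K) : Set (realSpace K) :=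
  open scoped Classical in
  (Set.univ.pi fun v ↦ if v = i then Set.Icc 0 η else Set.Icc 0 R)

theorem measurableSet_smallBox (R η : ℝ) (i : InfinitePlace K) :
    MeasurableSet (smallBox K R η i) := by
  classical
  refine MeasurableSet.univ_pi fun _ ↦ ?_
  split_ifs <;> exact measurableSet_Icc

theorem volume_smallBox_le {R η : ℝ} (hR : 1 ≤ R) (i : InfinitePlace K) :
    volume (smallBox K R η i) ≤
      ENNReal.ofReal η * ENNReal.ofReal R ^ (Fintype.card (InfinitePlace K)) := by
  classical
  rw [smallBox, volume_pi_pi, ← Finset.mul_prod_erase Finset.univ _ (Finset.mem_univ i), if_pos rfl,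
    Real.volume_Icc, sub_zero]
  gcongr
  calc _ ≤ ∏ v ∈ Finset.univ.erase i, ENNReal.ofReal R := by
        refine Finset.prod_le_prod' fun v hv => ?_
        rw [if_neg (Finset.ne_of_mem_erase hv), Real.volume_Icc, sub_zero]
    _ ≤ _ := by
      rw [Finset.prod_const]
      gcongr
      · rw [← ENNReal.ofReal_one]; gcongr
      · exact Finset.card_le_univ _


open scoped Classical in
theorem boundary_cover : ∃ R M : ℝ, 1 ≤ R ∧ 1 ≤ M ∧ ∀ η : ℝ, 0 < η → M * η ≤ 1 → 2 * η ≤ 1 →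
    {x : mixedSpace K | ∃ y, ‖x - y‖ ≤ η ^ 3 ∧ ¬ (x ∈ normLeOne K ↔ y ∈ normLeOne K)} ⊆
      (⋃ w, normAtAllPlaces ⁻¹' (smallBox K R η w)) ∪
      ⋃ i, (normAtAllPlaces ⁻¹' (expMapBasis '' (faceBox K (M * η ^ 2) η i 0)) ∪
        normAtAllPlaces ⁻¹' (expMapBasis '' (faceBox K (M * η ^ 2) η i 1))) := by
  obtain ⟨R, hR, hRS⟩ := (isBounded_normLeOne K).exists_pos_norm_le
  set Φ : realSpace K →L[ℝ] realSpace K := ((completeBasis K).equivFunL : realSpace K →L[ℝ] realSpace K) with hΦ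
  refine ⟨R + 1, 4 * ‖Φ‖ + 1, by linarith, by linarith [norm_nonneg Φ], ?_⟩
  intro η hη hM hη2
  have hη3 : η ^ 3 ≤ η / 2 := by nlinarith [pow_pos hη 3, pow_pos hη 2, mul_pos hη hη]
  rintro x ⟨y, hxy, hne⟩
  have hη1 : η ^ 3 ≤ 1 := by linarith
  have hxR : ‖x‖ ≤ R + 1 := by
    by_cases hx : x ∈ normLeOne K
    · linarith [hRS x hx]
    · have hy : y ∈ normLeOne K := by tauto
      have := norm_le_norm_add_norm_sub y x
      rw [norm_sub_rev] at this
      linarith [hRS y hy]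
  by_cases hsmall : ∃ w, normAtPlace w x < η
  · left
    obtain ⟨w, hw⟩ := hsmall
    refine Set.mem_iUnion.2 ⟨w, ?_⟩
    simp only [smallBox, Set.mem_preimage, Set.mem_univ_pi]
    intro v
    rw [normAtAllPlaces_apply]
    split_ifs with hv
    · subst hv; exact ⟨normAtPlace_nonneg _ _, hw.le⟩
    · exact ⟨normAtPlace_nonneg _ _, (normAtPlace_le_norm' K x v).trans hxR⟩
  right
  push Not at hsmall
  have hd := abs_normAtPlace_sub_le K x y
  have hy : ∀ w, 0 < normAtPlace w y := by
    intro w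
    have := abs_le.1 ((hd w).trans hxy)
    linarith [hsmall w]
  set u := Φ (expMap.symm (normAtAllPlaces x)) with hu
  set v := Φ (expMap.symm (normAtAllPlaces y)) with hv
  have hux : expMapBasis u = normAtAllPlaces x :=
    expMapBasis.right_inv (Set.mem_univ_pi.mpr fun w => hη.trans_le (hsmall w))
  have hvy : expMapBasis v = normAtAllPlaces y :=
    expMapBasis.right_inv (Set.mem_univ_pi.mpr hy)
  rw [normLeOne_eq_preimage, Set.mem_preimage, Set.mem_preimage, ← hux, ← hvy,
    (injective_expMapBasis K).mem_set_image, (injective_expMapBasis K).mem_set_image] at hne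
  have huv : ‖u - v‖ ≤ (4 * ‖Φ‖ + 1) * η ^ 2 := by
    rw [hu, hv, ← map_sub]
    have h1 : ‖expMap.symm (normAtAllPlaces x) - expMap.symm (normAtAllPlaces y)‖ ≤ 4 * η ^ 2 := by
      rw [pi_norm_le_iff_of_nonneg (by positivity)]
      intro w
      rw [Pi.sub_apply, expMap_symm_apply, expMap_symm_apply, ← mul_sub, norm_mul]
      have h2 : ‖(w.mult : ℝ)‖ ≤ 2 := by
        rw [Real.norm_natCast, InfinitePlace.mult]
        split_ifs <;> norm_num
      have h3 : ‖Real.log (normAtAllPlaces x w) - Real.log (normAtAllPlaces y w)‖ ≤ 2 * η ^ 2 := by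
        refine (abs_log_sub_le hη (hsmall w) ((hd w).trans hxy) hη3).trans (le_of_eq ?_)
        field_simp
      calc _ ≤ 2 * (2 * η ^ 2) := mul_le_mul h2 h3 (norm_nonneg _) (by norm_num)
        _ = _ := by ring
    refine (Φ.le_opNorm _).trans ?_
    nlinarith [norm_nonneg Φ, pow_pos hη 2]
  have hlow : -(1 / η) ≤ u w₀ := by
    have h1 := prod_expMapBasis_pow u
    rw [hux] at h1
    have h2 : η ^ Module.finrank ℚ K ≤ ∏ w : InfinitePlace K, (normAtAllPlaces x w) ^ w.mult := by
      rw [← sum_mult_eq, ← Finset.prod_pow_eq_pow_sum]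
      refine Finset.prod_le_prod (fun _ _ => by positivity) fun w _ => ?_
      exact pow_le_pow_left₀ hη.le (hsmall w) _
    rw [h1] at h2
    have h3 : η ≤ Real.exp (u w₀) :=
      (pow_le_pow_iff_left₀ hη.le (Real.exp_pos _).le Module.finrank_pos.ne').1 h2
    have h4 := (Real.log_le_iff_le_exp hη).2 h3
    have h5 := Real.one_sub_inv_le_log_of_pos hη
    rw [one_div]
    linarith
  have hκ1 : (4 * ‖Φ‖ + 1) * η ^ 2 ≤ 1 := by nlinarith [norm_nonneg Φ]
  obtain ⟨i, hi⟩ := exists_mem_faceBox K (κ := (4 * ‖Φ‖ + 1) * η ^ 2) (η := η) hκ1 u v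
    (fun w => (norm_le_pi_norm (u - v) w).trans huv) hlow hne
  refine Set.mem_iUnion.2 ⟨i, ?_⟩
  rcases hi with hi | hi
  · left; exact ⟨u, hi, hux⟩
  · right; exact ⟨u, hi, hux⟩

open scoped Classical in
theorem volume_boundary_le : ∃ C η₀ : ℝ, 0 ≤ C ∧ 0 < η₀ ∧ ∀ η : ℝ, 0 < η → η ≤ η₀ →
    volume {x : mixedSpace K | ∃ y, ‖x - y‖ ≤ η ^ 3 ∧ ¬ (x ∈ normLeOne K ↔ y ∈ normLeOne K)} ≤
      ENNReal.ofReal (C * η) := by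
  obtain ⟨R, M, hR, hM, hcov⟩ := boundary_cover K
  obtain ⟨C₁, hC₁, h₁⟩ := volume_expMapBasis_le K
  obtain ⟨C₂, hC₂, h₂⟩ := volume_box_le K R
  set m := Fintype.card (InfinitePlace K)
  refine ⟨m * (C₂ * R ^ m) + m * (2 * (C₁ * (2 * M * 3 ^ m))), min (1 / M) (1 / 2), by positivity,
    by positivity, ?_⟩
  intro η hη hη₀
  have hη1 : M * η ≤ 1 := by
    have := hη₀.trans (min_le_left _ _)
    rw [le_div_iff₀ (by linarith)] at this
    linarith
  have hη2 : 2 * η ≤ 1 := by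
    have := hη₀.trans (min_le_right _ _)
    linarith
  have hs : ∀ w, volume (normAtAllPlaces ⁻¹' (smallBox K R η w)) ≤
      ENNReal.ofReal (C₂ * R ^ m * η) := by
    intro w
    refine (h₂ _ (measurableSet_smallBox K R η w) ?_).trans ?_
    · intro u hu v
      have := hu v trivial
      by_cases h : v = w
      · simp only [h, if_true] at this ⊢
        exact ⟨this.1, by linarith [this.2]⟩
      · simp only [h, if_false] at this
        exact this
    · refine (mul_le_mul_right (volume_smallBox_le K hR w) _).trans (le_of_eq ?_)
      rw [← ENNReal.ofReal_pow (by linarith), ← ENNReal.ofReal_mul hη.le, ← ENNReal.ofReal_mul hC₂]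
      congr 1
      ring
  have hf : ∀ i c, volume (normAtAllPlaces ⁻¹' (expMapBasis '' (faceBox K (M * η ^ 2) η i c))) ≤
      ENNReal.ofReal (C₁ * (2 * M * 3 ^ m) * η) := by
    intro i c
    refine (h₁ _ (measurableSet_faceBox K _ η i c) (fun u hu => hu.2)).trans ?_
    refine (mul_le_mul_right (volume_faceBox_le K hη (by linarith) i c) _).trans (le_of_eq ?_)
    rw [← ENNReal.ofReal_ofNat 3, ← ENNReal.ofReal_pow (by norm_num),
      ← ENNReal.ofReal_mul (by positivity), ← ENNReal.ofReal_mul (by positivity),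
      ← ENNReal.ofReal_mul hC₁]
    congr 1
    field_simp
    rfl
  refine (measure_mono (hcov η hη hη1 hη2)).trans ((measure_union_le _ _).trans ?_)
  rw [add_mul, ENNReal.ofReal_add (by positivity) (by positivity)]
  gcongr
  · refine (measure_iUnion_fintype_le _ _).trans ((Finset.sum_le_sum fun w _ => hs w).trans ?_)
    rw [Finset.sum_const, Finset.card_univ, nsmul_eq_mul, ← ENNReal.ofReal_natCast,
      ← ENNReal.ofReal_mul (by positivity)]
    exact ENNReal.ofReal_le_ofReal (le_of_eq (by ring))
  · refine (measure_iUnion_fintype_le _ _).trans ((Finset.sum_le_sum fun w _ =>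
      (measure_union_le _ _).trans (add_le_add (hf w 0) (hf w 1))).trans ?_)
    rw [Finset.sum_const, Finset.card_univ, nsmul_eq_mul, ← ENNReal.ofReal_natCast,
      ← ENNReal.ofReal_add (by positivity) (by positivity), ← ENNReal.ofReal_mul (by positivity)]
    exact ENNReal.ofReal_le_ofReal (le_of_eq (by ring))

open MeasureTheory Pointwise in
theorem lattice_count_aux {E : Type*} [NormedAddCommGroup E] [NormedSpace ℝ E]
    [FiniteDimensional ℝ E] [MeasurableSpace E] [BorelSpace E] (μ : Measure E)
    [μ.IsAddHaarMeasure] (L : Submodule ℤ E) [DiscreteTopology L] [IsZLattice ℝ L] :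
    ∃ r : ℝ, 0 < r ∧ ∀ A : Set E, Bornology.IsBounded A → ∀ V : ℝ, 0 ≤ V →
      μ {x | ∃ y, ‖x - y‖ ≤ r ∧ ¬ (x ∈ A ↔ y ∈ A)} ≤ ENNReal.ofReal V →
      |(Nat.card (A ∩ L : Set E) : ℝ) * ZLattice.covolume L μ - μ.real A| ≤ V := by
  classical
  set b := (Module.Free.chooseBasis ℤ L) with hb
  set F := ZSpan.fundamentalDomain (b.ofZLatticeBasis ℝ) with hF
  have hfd : IsAddFundamentalDomain L F μ := ZLattice.isAddFundamentalDomain b μ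
  have hFb : Bornology.IsBounded F := ZSpan.fundamentalDomain_isBounded _
  obtain ⟨r, hr, hFr⟩ := hFb.exists_pos_norm_le
  refine ⟨r, hr, fun A hA V hV hB => ?_⟩
  set B := {x | ∃ y, ‖x - y‖ ≤ r ∧ ¬ (x ∈ A ↔ y ∈ A)} with hBdef
  have hfin : (A ∩ L : Set E).Finite := by
    have : DiscreteTopology L.toAddSubgroup := (inferInstance : DiscreteTopology L)
    exact Metric.finite_isBounded_inter_isClosed DiscreteTopology.isDiscrete hA
      (AddSubgroup.isClosed_of_discrete (H := L.toAddSubgroup))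
  have hfinL : {l : L | (l : E) ∈ A}.Finite := by
    refine Set.Finite.of_finite_image (f := ((↑) : L → E)) (hfin.subset ?_)
      Subtype.val_injective.injOn
    rintro _ ⟨l, hl, rfl⟩
    exact ⟨hl, l.2⟩
  set S := hfinL.toFinset with hS
  have hcard : Nat.card (A ∩ L : Set E) = S.card := by
    rw [hS, ← Nat.card_eq_card_finite_toFinset]
    refine Nat.card_congr ⟨fun x => ⟨⟨x.1, x.2.2⟩, x.2.1⟩, fun x => ⟨x.1.1, x.2, x.1.2⟩,
      fun _ => rfl, fun _ => rfl⟩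
  set U : Set E := ⋃ l ∈ S, (l +ᵥ F) with hU
  have : MeasurableVAdd L E := (inferInstance : MeasurableVAdd L.toAddSubgroup E)
  have : VAddInvariantMeasure L E μ := (inferInstance : VAddInvariantMeasure L.toAddSubgroup E μ)
  have hUm : μ U = S.card * μ F := by
    rw [hU, measure_biUnion_finset₀]
    · simp [measure_vadd]
    · intro l _ l' _ h
      exact hfd.aedisjoint h
    · intro l _
      exact hfd.nullMeasurableSet_vadd l
  have hAU : A ⊆ U ∪ B := by
    intro x hx
    obtain ⟨l, hl, -⟩ := ZSpan.exist_unique_vadd_mem_fundamentalDomain (b.ofZLatticeBasis ℝ) x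
    have hl2 : (l : E) ∈ L := by
      have h0 := b.ofZLatticeBasis_span ℝ (L := L)
      have h1 := l.2
      exact (congrArg (fun M : Submodule ℤ E => (l : E) ∈ M) h0).mp h1
    set l' : L := ⟨l, hl2⟩
    have hl3 : (l : E) + x ∈ F := hl
    by_cases h : ((-l' : L) : E) ∈ A
    · left
      rw [hU]
      refine Set.mem_iUnion₂.2 ⟨-l', by simpa [hS] using h, ?_⟩
      rw [Set.mem_vadd_set_iff_neg_vadd_mem]
      rw [neg_neg]
      exact hl3
    · right
      refine ⟨((-l' : L) : E), ?_, ?_⟩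
      · have := hFr _ hl3
        simpa [l', add_comm] using this
      · tauto
  have hUA : U ⊆ A ∪ B := by
    intro x hx
    by_cases hxA : x ∈ A
    · exact Or.inl hxA
    right
    obtain ⟨l, hl, hx⟩ := Set.mem_iUnion₂.1 hx
    rw [Set.mem_vadd_set_iff_neg_vadd_mem] at hx
    refine ⟨l, ?_, ?_⟩
    · have h1 : -(l : E) + x ∈ F := hx
      have := hFr _ h1
      rwa [sub_eq_neg_add]
    · have : (l : E) ∈ A := by simpa [hS] using hl
      tauto
  have hμA : μ A ≠ ⊤ := hA.measure_lt_top.ne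
  have hμF : μ F ≠ ⊤ := hFb.measure_lt_top.ne
  have hμU : μ U ≠ ⊤ := by rw [hUm]; exact ENNReal.mul_ne_top (by simp) hμF
  have hμB : μ B ≠ ⊤ := (hB.trans_lt ENNReal.ofReal_lt_top).ne
  have hμBV : μ.real B ≤ V := by
    rw [measureReal_def]; exact ENNReal.toReal_le_of_le_ofReal hV hB
  have h1 : μ.real U = S.card * μ.real F := by
    simp [measureReal_def, hUm]
  have h2 : μ.real A ≤ μ.real U + μ.real B :=
    (measureReal_mono hAU (by finiteness)).trans (measureReal_union_le _ _)
  have h3 : μ.real U ≤ μ.real A + μ.real B :=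
    (measureReal_mono hUA (by finiteness)).trans (measureReal_union_le _ _)
  rw [hcard, ZLattice.covolume_eq_measure_fundamentalDomain L μ hfd, ← h1, abs_le]
  constructor <;> linarith


end volumes

section count
open NumberField.InfinitePlace NumberField.mixedEmbedding NumberField.mixedEmbedding.fundamentalCone
open MeasureTheory ENNReal NumberField.Units NumberField.Units.dirichletUnitTheorem Submodule
open scoped Real nonZeroDivisors


open scoped Classical Pointwise in
theorem smul_normLeOne {t : ℝ} (ht : 0 < t) :
    {x : mixedSpace K | x ∈ fundamentalCone K ∧
      mixedEmbedding.norm x ≤ t ^ Module.finrank ℚ K} = t • normLeOne K := by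
  ext x
  rw [Set.mem_smul_set_iff_inv_smul_mem₀ ht.ne', mem_normLeOne,
    smul_mem_iff_mem (inv_ne_zero ht.ne'), mixedEmbedding.norm_smul, abs_of_pos (inv_pos.2 ht),
    inv_pow, inv_mul_le_iff₀ (by positivity), mul_one]
  rfl

open scoped Classical Pointwise in
theorem cone_count (J : (FractionalIdeal (𝓞 K)⁰ K)ˣ) : ∃ C s₀ : ℝ, 0 ≤ C ∧ ∀ s : ℝ, s₀ ≤ s → 1 ≤ s →
    |(Nat.card ({x : mixedSpace K | x ∈ fundamentalCone K ∧ mixedEmbedding.norm x ≤ s} ∩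
      (idealLattice K J : Set (mixedSpace K)) : Set (mixedSpace K)) : ℝ) * ZLattice.covolume (idealLattice K J) -
      volume.real (normLeOne K) * s| ≤ C * s ^ (1 - 1 / (3 * (Module.finrank ℚ K : ℝ))) := by
  obtain ⟨r, hr, hL⟩ := lattice_count_aux (volume : Measure (mixedSpace K)) (idealLattice K J)
  obtain ⟨C, η₀, hC, hη₀, hB⟩ := volume_boundary_le K
  set n := Module.finrank ℚ K with hn
  have hn0 : (n : ℝ) ≠ 0 := Nat.cast_ne_zero.2 Module.finrank_pos.ne'
  have hn0' : (0 : ℝ) < n := Nat.cast_pos.2 Module.finrank_pos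
  refine ⟨C * r ^ (1 / 3 : ℝ), (r / η₀ ^ 3) ^ n, by positivity, ?_⟩
  intro s hs hs1
  have hs0 : 0 < s := by linarith
  set t := s ^ (1 / (n : ℝ)) with ht
  have ht0 : 0 < t := Real.rpow_pos_of_pos hs0 _
  have htn : t ^ n = s := by
    rw [ht, ← Real.rpow_natCast, ← Real.rpow_mul hs0.le, one_div_mul_cancel hn0, Real.rpow_one]
  set η := (r / t) ^ (1 / 3 : ℝ) with hη
  have hη3 : η ^ 3 = r / t := by
    rw [hη, ← Real.rpow_natCast, ← Real.rpow_mul (by positivity)]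
    norm_num
  have hη0 : 0 < η := by positivity
  have hηη : η ≤ η₀ := by
    have h1 : r / η₀ ^ 3 ≤ t := by
      rw [← htn] at hs
      exact (pow_le_pow_iff_left₀ (by positivity) ht0.le (Module.finrank_pos.ne')).1 hs
    refine (pow_le_pow_iff_left₀ hη0.le hη₀.le (n := 3) (by norm_num)).1 ?_
    rw [hη3, div_le_iff₀ ht0]
    rw [div_le_iff₀ (by positivity)] at h1
    linarith
  have hset : {x : mixedSpace K | x ∈ fundamentalCone K ∧ mixedEmbedding.norm x ≤ s} =
      t • normLeOne K := by
    rw [← smul_normLeOne K ht0, htn]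
  rw [hset]
  have hvol : volume.real (normLeOne K) * s = volume.real (t • normLeOne K) := by
    rw [measureReal_def, measureReal_def, Measure.addHaar_smul, mixedEmbedding.finrank, ← hn, htn,
      abs_of_pos hs0, ENNReal.toReal_mul, ENNReal.toReal_ofReal hs0.le, mul_comm]
  rw [hvol]
  have hV : C * r ^ (1 / 3 : ℝ) * s ^ (1 - 1 / (3 * (n : ℝ))) = s * (C * η) := by
    rw [hη, Real.div_rpow hr.le ht0.le, ht, ← Real.rpow_mul hs0.le, Real.rpow_sub hs0, Real.rpow_one]
    have : 1 / (n : ℝ) * (1 / 3) = 1 / (3 * n) := by field_simp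
    rw [this]
    ring
  rw [hV]
  refine hL _ ((isBounded_normLeOne K).smul₀ t) _ (by positivity) ?_
  calc _ ≤ volume (t • {x : mixedSpace K | ∃ y, ‖x - y‖ ≤ η ^ 3 ∧
        ¬ (x ∈ normLeOne K ↔ y ∈ normLeOne K)}) := by
        refine measure_mono ?_
        rintro x ⟨y, hxy, h⟩
        rw [Set.mem_smul_set_iff_inv_smul_mem₀ ht0.ne'] at h ⊢
        rw [Set.mem_smul_set_iff_inv_smul_mem₀ ht0.ne'] at h
        refine ⟨t⁻¹ • y, ?_, h⟩
        rw [← smul_sub, _root_.norm_smul, norm_inv, Real.norm_of_nonneg ht0.le, hη3, inv_mul_le_iff₀ ht0]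
        field_simp
        exact hxy
    _ ≤ _ := by
        rw [Measure.addHaar_smul, mixedEmbedding.finrank, ← hn, htn, abs_of_pos hs0,
          ENNReal.ofReal_mul hs0.le]
        gcongr
        exact hB η hη0 hηη

theorem class_count_aux {C : ClassGroup (𝓞 K)} {J : (Ideal (𝓞 K))⁰} {s : ℝ}
    (hJ : ClassGroup.mk0 J = C⁻¹) :
    Nat.card {I : (Ideal (𝓞 K))⁰ // absNorm (I : Ideal (𝓞 K)) ≤ s ∧ ClassGroup.mk0 I = C}
      = Nat.card {I : (Ideal (𝓞 K))⁰ // (J : Ideal (𝓞 K)) ∣ I ∧ IsPrincipal (I : Ideal (𝓞 K)) ∧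
        absNorm (I : Ideal (𝓞 K)) ≤ s * absNorm (J : Ideal (𝓞 K))} := by
  simp_rw [← nonZeroDivisors_dvd_iff_dvd_coe]
  refine Nat.card_congr ?_
  refine ((Equiv.dvd J).subtypeEquiv fun I ↦ ?_).trans
    (Equiv.subtypeSubtypeEquivSubtypeInter (fun I : (Ideal (𝓞 K))⁰ ↦ J ∣ I) _)
  rw [← ClassGroup.mk0_eq_one_iff (SetLike.coe_mem _)]
  simp_rw [Equiv.dvd_apply, Submonoid.coe_mul, ← Submonoid.mul_def, _root_.map_mul, hJ,
    inv_mul_eq_one, Nat.cast_mul, mul_comm s, eq_comm, and_comm, and_congr_left_iff]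
  exact fun _ ↦
    (mul_le_mul_iff_of_pos_left (Nat.cast_pos.mpr (absNorm_pos_of_nonZeroDivisors J))).symm

theorem class_count (c : ClassGroup (𝓞 K)) : ∃ C s₀ : ℝ, 0 ≤ C ∧ ∀ s : ℝ, s₀ ≤ s → 1 ≤ s →
    |(Nat.card {I : (Ideal (𝓞 K))⁰ //
        absNorm (I : Ideal (𝓞 K)) ≤ s ∧ ClassGroup.mk0 I = c} : ℝ) -
      ((2 ^ nrRealPlaces K * (2 * π) ^ nrComplexPlaces K * regulator K) /
            (torsionOrder K * Real.sqrt |discr K|)) * s| ≤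
      C * s ^ (1 - 1 / (3 * (Module.finrank ℚ K : ℝ))) := by
  classical
  obtain ⟨J, hJ⟩ := ClassGroup.mk0_surjective c⁻¹
  set N : ℝ := (absNorm J.1 : ℝ) with hN
  have hN1 : 1 ≤ N := by
    rw [hN]; exact_mod_cast absNorm_pos_of_nonZeroDivisors J
  obtain ⟨C, s₀, hC, h⟩ := cone_count K (FractionalIdeal.mk0 K J)
  set δ : ℝ := 1 - 1 / (3 * (Module.finrank ℚ K : ℝ))
  set V := ZLattice.covolume (idealLattice K (FractionalIdeal.mk0 K J)) with hV
  have hVpos : 0 < V := ZLattice.covolume_pos _ _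
  have hw : (0 : ℝ) < torsionOrder K := Nat.cast_pos.2 (torsionOrder_pos K)
  have hVeq : V = N * (2 : ℝ)⁻¹ ^ nrComplexPlaces K * √|discr K| := by
    rw [hV, covolume_idealLattice, FractionalIdeal.coe_mk0, FractionalIdeal.coeIdeal_absNorm,
      Rat.cast_natCast]
  have hd : (0 : ℝ) < √|discr K| := by
    have : (discr K : ℝ) ≠ 0 := Int.cast_ne_zero.2 (discr_ne_zero K)
    positivity
  have hvol : volume.real (normLeOne K) =
      2 ^ nrRealPlaces K * π ^ nrComplexPlaces K * regulator K := by
    rw [measureReal_def, volume_normLeOne]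
    simp [(regulator_pos K).le]
  refine ⟨C * N ^ δ / (torsionOrder K * V), s₀ ⊔ 0, by positivity, ?_⟩
  intro s hs hs1
  have hsN : s ≤ s * N := by nlinarith
  have h1 := h (s * N) ((le_sup_left.trans hs).trans hsN) (hs1.trans hsN)
  have hcard : (Nat.card ({x : mixedSpace K | x ∈ fundamentalCone K ∧ mixedEmbedding.norm x ≤ s * N} ∩
      (idealLattice K (FractionalIdeal.mk0 K J) : Set (mixedSpace K)) : Set (mixedSpace K)) : ℝ)
      = (Nat.card {I : (Ideal (𝓞 K))⁰ //
        absNorm (I : Ideal (𝓞 K)) ≤ s ∧ ClassGroup.mk0 I = c} : ℝ) * torsionOrder K := by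
    rw [class_count_aux K hJ, ← Nat.cast_mul, card_isPrincipal_dvd_norm_le]
    congr 1
    refine Nat.card_congr ⟨fun x => ⟨⟨x.1, x.2.1.1, x.2.2⟩, x.2.1.2⟩,
      fun x => ⟨x.1.1, ⟨x.1.2.1, x.2⟩, x.1.2.2⟩, fun _ => rfl, fun _ => rfl⟩
  rw [hcard] at h1
  rw [Real.mul_rpow (by linarith) (by linarith)] at h1
  set m : ℝ := (Nat.card {I : (Ideal (𝓞 K))⁰ //
        absNorm (I : Ideal (𝓞 K)) ≤ s ∧ ClassGroup.mk0 I = c} : ℝ)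
  set κ := ((2 ^ nrRealPlaces K * (2 * π) ^ nrComplexPlaces K * regulator K) /
            (torsionOrder K * Real.sqrt |discr K|)) with hκ
  have hκ' : volume.real (normLeOne K) * (s * N) = κ * s * (torsionOrder K * V) := by
    rw [hvol, hVeq, hκ, mul_pow, inv_pow]
    field_simp
  have e : m * torsionOrder K * V - volume.real (normLeOne K) * (s * N)
      = (m - κ * s) * (torsionOrder K * V) := by
    rw [hκ']; ring
  rw [e, abs_mul, abs_of_pos (a := _ * V) (by positivity), ← le_div_iff₀ (by positivity)] at h1
  refine h1.trans (le_of_eq ?_)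
  ring

theorem ideal_count_large : ∃ C s₀ : ℝ, 0 ≤ C ∧ ∀ s : ℝ, s₀ ≤ s → 1 ≤ s →
    |(Nat.card {I : (Ideal (𝓞 K))⁰ // absNorm (I : Ideal (𝓞 K)) ≤ s} : ℝ) - cK K * s| ≤
      C * s ^ (1 - 1 / (3 * (Module.finrank ℚ K : ℝ))) := by
  classical
  choose C s₀ hC h using class_count K
  refine ⟨∑ c, C c, ∑ c, |s₀ c|, Finset.sum_nonneg fun c _ => hC c, ?_⟩
  intro s hs hs1
  have hs0 : 0 ≤ s := by linarith
  have hsum : (Nat.card {I : (Ideal (𝓞 K))⁰ // absNorm (I : Ideal (𝓞 K)) ≤ s} : ℝ) =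
      ∑ c, (Nat.card {I : (Ideal (𝓞 K))⁰ //
        absNorm (I : Ideal (𝓞 K)) ≤ s ∧ ClassGroup.mk0 I = c} : ℝ) := by
    have : Fintype {I : (Ideal (𝓞 K))⁰ // absNorm (I : Ideal (𝓞 K)) ≤ s} := by
      simp_rw [← Nat.le_floor_iff hs0]
      refine @Fintype.ofFinite _ (finite_setOfPred_absNorm_le₀ ⌊s⌋₊)
    let e := fun C : ClassGroup (𝓞 K) ↦ Equiv.subtypeSubtypeEquivSubtypeInter
      (fun I : (Ideal (𝓞 K))⁰ ↦ absNorm I.1 ≤ s) (fun I ↦ ClassGroup.mk0 I = C)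
    simp_rw [← Nat.card_congr (e _), Nat.card_eq_fintype_card, Fintype.subtype_card]
    rw [Fintype.card, Finset.card_eq_sum_card_fiberwise (f := fun I ↦ ClassGroup.mk0 I.1)
      (t := Finset.univ) (fun _ _ ↦ Finset.mem_univ _), Nat.cast_sum]
  have hcK : cK K * s = ∑ c : ClassGroup (𝓞 K),
      ((2 ^ nrRealPlaces K * (2 * π) ^ nrComplexPlaces K * regulator K) /
            (torsionOrder K * Real.sqrt |discr K|)) * s := by
    rw [Finset.sum_const, Finset.card_univ, nsmul_eq_mul, cK, classNumber]
    ring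
  rw [hsum, hcK, ← Finset.sum_sub_distrib, Finset.sum_mul]
  refine (Finset.abs_sum_le_sum_abs _ _).trans (Finset.sum_le_sum fun c _ => ?_)
  refine h c s (((le_abs_self _).trans ?_).trans hs) hs1
  exact Finset.single_le_sum (f := fun c => |s₀ c|) (fun _ _ => abs_nonneg _) (Finset.mem_univ c)

theorem finite_norm_le (s : ℝ) : {a : Ideal (𝓞 K) | (absNorm a : ℝ) ≤ s}.Finite := by
  refine (finite_setOfPred_absNorm_le (S := 𝓞 K) ⌊s⌋₊).subset fun a ha => ?_
  exact Nat.le_floor ha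

theorem ideal_count_asymp : ∃ C : ℝ, 0 ≤ C ∧ ∀ s : ℝ, 1 ≤ s →
    |(idealCount K s : ℝ) - cK K * s| ≤
      C * s ^ (1 - 1 / (3 * (Module.finrank ℚ K : ℝ))) := by
  obtain ⟨C, s₀, hC, h⟩ := ideal_count_large K
  have heq : ∀ s : ℝ, Nat.card {I : (Ideal (𝓞 K))⁰ // absNorm (I : Ideal (𝓞 K)) ≤ s} =
      idealCount K s := by
    intro s
    refine Nat.card_congr ⟨fun x => ⟨x.1.1, nonZeroDivisors.ne_zero x.1.2, x.2⟩,
      fun x => ⟨⟨x.1, mem_nonZeroDivisors_of_ne_zero x.2.1⟩, x.2.2⟩, fun _ => rfl, fun _ => rfl⟩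
  simp_rw [heq] at h
  set δ : ℝ := 1 - 1 / (3 * (Module.finrank ℚ K : ℝ)) with hδ
  have hδ0 : 0 ≤ δ := by
    have : (1 : ℝ) ≤ Module.finrank ℚ K := by exact_mod_cast (Module.finrank_pos (R := ℚ) (M := K))
    rw [hδ, sub_nonneg, div_le_one (by positivity)]
    linarith
  refine ⟨C + (idealCount K s₀ + |cK K| * |s₀|), by positivity, fun s hs => ?_⟩
  have h1 : 1 ≤ s ^ δ := Real.one_le_rpow hs hδ0
  by_cases hss : s₀ ≤ s
  · refine (h s hss hs).trans ?_
    gcongr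
    have : 0 ≤ (idealCount K s₀ + |cK K| * |s₀|) := by positivity
    linarith
  · push Not at hss
    have hmono : (idealCount K s : ℝ) ≤ idealCount K s₀ := by
      have hf : Finite {a : Ideal (𝓞 K) // a ≠ ⊥ ∧ (absNorm a : ℝ) ≤ s₀} :=
        ((finite_norm_le K s₀).subset fun a ha => ha.2 : {a : Ideal (𝓞 K) | a ≠ ⊥ ∧ (absNorm a : ℝ) ≤ s₀}.Finite)
      refine Nat.cast_le.2 (Nat.card_le_card_of_injective
        (fun x : {a : Ideal (𝓞 K) // a ≠ ⊥ ∧ (absNorm a : ℝ) ≤ s} =>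
          (⟨x.1, x.2.1, x.2.2.trans hss.le⟩ : {a : Ideal (𝓞 K) // a ≠ ⊥ ∧ (absNorm a : ℝ) ≤ s₀})) ?_)
      intro x y hxy
      simpa [Subtype.ext_iff] using hxy
    calc _ ≤ |(idealCount K s : ℝ)| + |cK K * s| := abs_sub _ _
      _ ≤ idealCount K s₀ + |cK K| * |s₀| := by
        rw [abs_mul, abs_of_nonneg (a := (idealCount K s : ℝ)) (by positivity)]
        gcongr
      _ ≤ C + (idealCount K s₀ + |cK K| * |s₀|) := by linarith
      _ ≤ _ := le_mul_of_one_le_right (by positivity) h1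


end count

section qsum
open Finset

/-- nonzero ideals of norm at most `X`. -/
def nzI (X : ℝ) : Finset (Ideal (𝓞 K)) :=
  ((finite_norm_le K X).subset (fun _ h => h.2 :
    {a : Ideal (𝓞 K) | a ≠ ⊥ ∧ (absNorm a : ℝ) ≤ X} ⊆ _)).toFinset

theorem mem_nzI {X : ℝ} {a : Ideal (𝓞 K)} : a ∈ nzI K X ↔ a ≠ ⊥ ∧ (absNorm a : ℝ) ≤ X := by
  simp [nzI]

theorem card_nzI (X : ℝ) : (nzI K X).card = idealCount K X := by
  exact (Nat.subtype_card _ fun x => mem_nzI K).symm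

theorem one_le_absNorm {a : Ideal (𝓞 K)} (ha : a ≠ ⊥) : 1 ≤ absNorm a :=
  Nat.one_le_iff_ne_zero.2 fun h => ha (absNorm_eq_zero_iff.1 h)

theorem card_nzI_le : ∃ C : ℝ, 0 ≤ C ∧ ∀ X : ℝ, 0 ≤ X → ((nzI K X).card : ℝ) ≤ C * X := by
  obtain ⟨C, hC, h⟩ := ideal_count_asymp K
  refine ⟨C + |cK K|, by positivity, fun X hX => ?_⟩
  by_cases h1 : 1 ≤ X
  · have h2 := (abs_le.1 (h X h1)).2
    rw [card_nzI]
    have h3 : X ^ (1 - 1 / (3 * (Module.finrank ℚ K : ℝ))) ≤ X := by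
      conv_rhs => rw [← Real.rpow_one X]
      refine Real.rpow_le_rpow_of_exponent_le h1 ?_
      have : 0 ≤ 1 / (3 * (Module.finrank ℚ K : ℝ)) := by positivity
      linarith
    have h4 : cK K * X ≤ |cK K| * X := by gcongr; exact le_abs_self _
    have h5 := mul_le_mul_of_nonneg_left h3 hC
    linarith
  · have : nzI K X = ∅ := by
      ext a
      simp only [mem_nzI, Finset.notMem_empty, iff_false, not_and]
      intro ha hX'
      have : (1 : ℝ) ≤ absNorm a := by exact_mod_cast one_le_absNorm K ha
      linarith
    rw [this]; simp; positivity

open Classical in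
/-- primes of norm exactly `m`. -/
def prF (m : ℕ) : Finset (Ideal (𝓞 K)) := (nzI K m).filter fun p => p.IsPrime ∧ absNorm p = m

theorem mem_prF {m : ℕ} {p : Ideal (𝓞 K)} :
    p ∈ prF K m ↔ p ≠ ⊥ ∧ p.IsPrime ∧ absNorm p = m := by
  simp only [prF, Finset.mem_filter, mem_nzI]
  constructor
  · rintro ⟨⟨h, -⟩, h2⟩; exact ⟨h, h2⟩
  · rintro ⟨h, h2, h3⟩; exact ⟨⟨h, by rw [h3]⟩, h2, h3⟩

theorem two_le_absNorm {p : Ideal (𝓞 K)} (hp : p.IsPrime) (h0 : p ≠ ⊥) : 2 ≤ absNorm p := by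
  have h1 := one_le_absNorm K h0
  have : absNorm p ≠ 1 := fun h => hp.ne_top (absNorm_eq_one_iff.1 h)
  omega

theorem card_prF_le (m : ℕ) : (prF K m).card ≤ Module.finrank ℚ K := by
  rcases (prF K m).eq_empty_or_nonempty with h | ⟨p, hp⟩
  · simp [h]
  have hp' := (mem_prF K).1 hp
  have hm : 2 ≤ m := by
    have := two_le_absNorm K hp'.2.1 hp'.1
    rwa [hp'.2.2] at this
  have hdvd : ∏ p ∈ prF K m, p ∣ Ideal.span {(m : 𝓞 K)} := by
    refine Finset.prod_primes_dvd _ (fun q hq => ?_) (fun q hq => ?_)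
    · have hq' := (mem_prF K).1 hq
      exact Ideal.prime_of_isPrime hq'.1 hq'.2.1
    · have hq' := (mem_prF K).1 hq
      rw [Ideal.dvd_span_singleton, ← hq'.2.2]
      exact absNorm_mem q
  have h2 := absNorm_dvd_absNorm_of_le (Ideal.le_of_dvd hdvd)
  rw [_root_.map_prod, Finset.prod_congr rfl (fun q hq => ((mem_prF K).1 hq).2.2),
    Finset.prod_const] at h2
  have h3 : absNorm (Ideal.span {(m : 𝓞 K)}) = m ^ Module.finrank ℚ K := by
    rw [Ideal.absNorm_span_natCast, RingOfIntegers.rank]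
  rw [h3] at h2
  exact (Nat.pow_dvd_pow_iff_le_right (by omega)).1 h2

theorem bddAbove_pr {a : Ideal (𝓞 K)} (ha : a ≠ ⊥) :
    BddAbove (absNorm '' {p : Ideal (𝓞 K) | p.IsPrime ∧ a ≤ p}) := by
  refine ⟨absNorm a, ?_⟩
  rintro _ ⟨p, ⟨-, hp⟩, rfl⟩
  exact Nat.le_of_dvd (one_le_absNorm K ha) (absNorm_dvd_absNorm_of_le hp)

theorem le_maxNorm {a p : Ideal (𝓞 K)} (ha : a ≠ ⊥) (hp : p.IsPrime) (h : a ≤ p) :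
    absNorm p ≤ maxNorm K a :=
  le_csSup (bddAbove_pr K ha) ⟨p, ⟨hp, h⟩, rfl⟩

theorem ne_bot_of_le {a p : Ideal (𝓞 K)} (ha : a ≠ ⊥) (h : a ≤ p) : p ≠ ⊥ := by
  rintro rfl; exact ha (le_bot_iff.1 h)

theorem exists_maxNorm {a : Ideal (𝓞 K)} (ha : a ≠ ⊥) (ha' : a ≠ ⊤) :
    ∃ p : Ideal (𝓞 K), p.IsPrime ∧ a ≤ p ∧ absNorm p = maxNorm K a := by
  obtain ⟨M, hM, haM⟩ := Ideal.exists_le_maximal a ha'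
  have : maxNorm K a ∈ absNorm '' {p : Ideal (𝓞 K) | p.IsPrime ∧ a ≤ p} :=
    Nat.sSup_mem ⟨_, M, ⟨hM.isPrime, haM⟩, rfl⟩ (bddAbove_pr K ha)
  obtain ⟨p, ⟨h1, h2⟩, h3⟩ := this
  exact ⟨p, h1, h2, h3⟩

open Classical in
theorem QS_eq {a : Ideal (𝓞 K)} (ha : a ≠ ⊥) :
    QS K Set.univ a = ((prF K (maxNorm K a)).filter fun p => a ≤ p).card := by
  refine Nat.subtype_card _ fun p => ?_
  simp only [Finset.mem_filter, mem_prF, Set.mem_univ, true_and]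
  constructor
  · rintro ⟨⟨-, h1, h2⟩, h3⟩; exact ⟨h1, h3, h2⟩
  · rintro ⟨h1, h3, h2⟩; exact ⟨⟨ne_bot_of_le K ha h3, h1, h2⟩, h3⟩

theorem QS_le {a : Ideal (𝓞 K)} (ha : a ≠ ⊥) : QS K Set.univ a ≤ Module.finrank ℚ K := by
  classical
  rw [QS_eq K ha]
  exact (Finset.card_filter_le _ _).trans (card_prF_le K _)

theorem one_le_QS {a : Ideal (𝓞 K)} (ha : a ≠ ⊥) (ha' : a ≠ ⊤) : 1 ≤ QS K Set.univ a := by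
  classical
  rw [QS_eq K ha, Nat.one_le_iff_ne_zero, Finset.card_ne_zero]
  obtain ⟨p, h1, h2, h3⟩ := exists_maxNorm K ha ha'
  exact ⟨p, by simp [mem_prF, h1, h2, h3, ne_bot_of_le K ha h2]⟩

open Classical in
theorem card_multiples_le (X : ℝ) {b : Ideal (𝓞 K)} (hb : b ≠ ⊥) :
    ((nzI K X).filter fun a => b ∣ a).card ≤ (nzI K (X / absNorm b)).card := by
  refine (Finset.card_le_card (t := (nzI K (X / absNorm b)).image (b * ·)) ?_).trans
    Finset.card_image_le
  intro a ha
  simp only [Finset.mem_filter, mem_nzI] at ha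
  obtain ⟨⟨h1, h2⟩, c, rfl⟩ := ha
  refine Finset.mem_image.2 ⟨c, (mem_nzI K).2 ⟨?_, ?_⟩, rfl⟩
  · rintro rfl; simp at h1
  · have : (0 : ℝ) < absNorm b := by exact_mod_cast one_le_absNorm K hb
    rw [le_div_iff₀ this]
    rw [_root_.map_mul, Nat.cast_mul] at h2
    linarith

open Classical in
theorem card_double_le {C : ℝ} (hC : 0 ≤ C)
    (h : ∀ X : ℝ, 0 ≤ X → ((nzI K X).card : ℝ) ≤ C * X) {X y : ℝ} (hX : 0 ≤ X) (hy : 1 ≤ y) :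
    (((nzI K X).filter fun a => y < maxNorm K a ∧ 2 ≤ QS K Set.univ a).card : ℝ) ≤
      (Module.finrank ℚ K : ℝ) ^ 2 * C * X * (2 / y) := by
  set n := Module.finrank ℚ K
  set A : ℕ → Ideal (𝓞 K) × Ideal (𝓞 K) → Finset (Ideal (𝓞 K)) := fun m pq =>
    (nzI K X).filter fun a => pq.1 * pq.2 ∣ a
  have hfl : 1 ≤ ⌊y⌋₊ := (Nat.one_le_floor_iff y).2 hy
  have hA : ∀ m : ℕ, ∀ pq ∈ prF K m ×ˢ prF K m, ((A m pq).card : ℝ) ≤ C * X * ((m : ℝ) ^ 2)⁻¹ := by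
    rintro m ⟨p, q⟩ hpq
    rw [Finset.mem_product, mem_prF, mem_prF] at hpq
    obtain ⟨⟨p0, pp, pm⟩, q0, qp, qm⟩ := hpq
    have := card_multiples_le K X (b := p * q) (mul_ne_zero p0 q0)
    refine (Nat.cast_le.2 this).trans ((h _ (by positivity)).trans (le_of_eq ?_))
    simp only at pm qm
    rw [_root_.map_mul, pm, qm]
    push_cast
    rw [div_eq_mul_inv, sq, mul_assoc]
  have hsub : ((nzI K X).filter fun a => y < maxNorm K a ∧ 2 ≤ QS K Set.univ a) ⊆
      (Finset.Ioc ⌊y⌋₊ (⌊y⌋₊ + ⌊X⌋₊)).biUnion fun m => (prF K m ×ˢ prF K m).biUnion (A m) := by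
    intro a ha
    simp only [Finset.mem_filter, mem_nzI] at ha
    obtain ⟨⟨h0, haX⟩, hy, hQ⟩ := ha
    rw [QS_eq K h0] at hQ
    obtain ⟨p, hp, q, hq, hpq⟩ := Finset.one_lt_card.1 hQ
    simp only [Finset.mem_filter] at hp hq
    have hp' := (mem_prF K).1 hp.1
    have hq' := (mem_prF K).1 hq.1
    simp only [Finset.mem_biUnion, Finset.mem_Ioc]
    refine ⟨maxNorm K a, ⟨(Nat.floor_lt (by linarith)).2 hy, ?_⟩, (p, q),
      Finset.mem_product.2 ⟨hp.1, hq.1⟩, ?_⟩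
    · refine le_trans ?_ (Nat.le_add_left _ _)
      refine Nat.le_floor (le_trans ?_ haX)
      rw [← hp'.2.2]
      exact_mod_cast Nat.le_of_dvd (one_le_absNorm K h0) (absNorm_dvd_absNorm_of_le hp.2)
    · simp only [A, Finset.mem_filter, mem_nzI]
      refine ⟨⟨h0, haX⟩, ?_⟩
      have : ∏ r ∈ {p, q}, r ∣ a := by
        refine Finset.prod_primes_dvd _ (fun r hr => ?_) (fun r hr => ?_)
        · simp only [Finset.mem_insert, Finset.mem_singleton] at hr
          rcases hr with rfl | rfl
          · exact Ideal.prime_of_isPrime hp'.1 hp'.2.1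
          · exact Ideal.prime_of_isPrime hq'.1 hq'.2.1
        · simp only [Finset.mem_insert, Finset.mem_singleton] at hr
          rcases hr with rfl | rfl
          · exact Ideal.dvd_iff_le.2 hp.2
          · exact Ideal.dvd_iff_le.2 hq.2
      rwa [Finset.prod_pair hpq] at this
  calc _ ≤ (((Finset.Ioc ⌊y⌋₊ (⌊y⌋₊ + ⌊X⌋₊)).biUnion
        fun m => (prF K m ×ˢ prF K m).biUnion (A m)).card : ℝ) :=
        Nat.cast_le.2 (Finset.card_le_card hsub)
    _ ≤ ∑ m ∈ Finset.Ioc ⌊y⌋₊ (⌊y⌋₊ + ⌊X⌋₊), ∑ pq ∈ prF K m ×ˢ prF K m, ((A m pq).card : ℝ) := by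
        refine (Nat.cast_le.2 Finset.card_biUnion_le).trans ?_
        push_cast
        refine Finset.sum_le_sum fun m _ => ?_
        exact (Nat.cast_le.2 Finset.card_biUnion_le).trans (by push_cast; rfl)
    _ ≤ ∑ m ∈ Finset.Ioc ⌊y⌋₊ (⌊y⌋₊ + ⌊X⌋₊), (n : ℝ) ^ 2 * (C * X * ((m : ℝ) ^ 2)⁻¹) := by
        refine Finset.sum_le_sum fun m _ => ?_
        refine (Finset.sum_le_card_nsmul _ _ _ (hA m)).trans ?_
        rw [nsmul_eq_mul, Finset.card_product]
        push_cast
        rw [← sq]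
        have : ((prF K m).card : ℝ) ≤ n := by exact_mod_cast card_prF_le K m
        gcongr
    _ = (n : ℝ) ^ 2 * C * X * ∑ m ∈ Finset.Ioc ⌊y⌋₊ (⌊y⌋₊ + ⌊X⌋₊), ((m : ℝ) ^ 2)⁻¹ := by
        rw [Finset.mul_sum]
        refine Finset.sum_congr rfl fun m _ => by ring
    _ ≤ _ := by
        refine mul_le_mul_of_nonneg_left ?_ (by positivity)
        refine (sum_Ioc_inv_sq_le_sub (by omega) (by omega)).trans ?_
        have h1 : y ≤ 2 * (⌊y⌋₊ : ℝ) := by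
          have := Nat.lt_floor_add_one y
          have : (1 : ℝ) ≤ ⌊y⌋₊ := by exact_mod_cast hfl
          linarith
        have h2 : ((⌊y⌋₊ : ℝ))⁻¹ ≤ 2 / y := by
          rw [inv_eq_one_div, div_le_div_iff₀ (by positivity) (by positivity)]
          linarith
        have : (0 : ℝ) ≤ ((⌊y⌋₊ + ⌊X⌋₊ : ℕ) : ℝ)⁻¹ := by positivity
        linarith

open Classical in
theorem smooth_sum_le (W P : Finset (Ideal (𝓞 K))) (hW : ∀ a ∈ W, a ≠ ⊥)
    (hP : ∀ p ∈ P, p ≠ ⊥ ∧ p.IsPrime)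
    (hWP : ∀ a ∈ W, ∀ p : Ideal (𝓞 K), p.IsPrime → a ≤ p → p ∈ P)
    (σ : ℝ) (hσ : ∀ p ∈ P, (absNorm p : ℝ) ^ (-σ) ≤ 3 / 4) :
    ∑ a ∈ W, (absNorm a : ℝ) ^ (-σ) ≤ Real.exp (4 * ∑ p ∈ P, (absNorm p : ℝ) ^ (-σ)) := by
  set φ : Ideal (𝓞 K) → P → ℕ := fun a p =>
    (UniqueFactorizationMonoid.normalizedFactors a).count p.1
  have hfac : ∀ a ∈ W, a = ∏ p : P, p.1 ^ φ a p := by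
    intro a ha
    conv_lhs => rw [← Ideal.prod_normalizedFactors_eq_self (hW a ha)]
    rw [Finset.prod_multiset_count]
    rw [Finset.prod_coe_sort P (fun p => p ^ (UniqueFactorizationMonoid.normalizedFactors a).count p)]
    refine Finset.prod_subset ?_ ?_
    · intro p hp
      rw [Multiset.mem_toFinset, Ideal.mem_normalizedFactors_iff (hW a ha)] at hp
      exact hWP a ha p hp.1 hp.2
    · intro p _ hp
      rw [Multiset.mem_toFinset] at hp
      rw [Multiset.count_eq_zero_of_notMem hp, pow_zero]
  set k := (W ×ˢ (Finset.univ : Finset P)).sup (fun x => φ x.1 x.2) + 1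
  have hk : ∀ a ∈ W, ∀ p : P, φ a p < k := by
    intro a ha p
    exact Nat.lt_succ_of_le (Finset.le_sup (f := fun x : _ × P => φ x.1 x.2)
      (Finset.mem_product.2 ⟨ha, Finset.mem_univ p⟩ : (a, p) ∈ _))
  have hinj : Set.InjOn φ (W : Set (Ideal (𝓞 K))) := by
    intro a ha b hb hab
    rw [hfac a ha, hfac b hb, hab]
  set f : Ideal (𝓞 K) → ℝ := fun a => (absNorm a : ℝ) ^ (-σ) with hf
  have hf0 : ∀ a, 0 ≤ f a := fun a => by positivity
  have hfmul : ∀ a ∈ W, f a = ∏ p : P, f p.1 ^ φ a p := by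
    intro a ha
    simp only [hf]
    conv_lhs => rw [hfac a ha]
    rw [_root_.map_prod, Nat.cast_prod, ← Real.finsetProd_rpow _ _ (fun _ _ => Nat.cast_nonneg _)]
    refine Finset.prod_congr rfl fun p _ => ?_
    rw [_root_.map_pow, Nat.cast_pow, ← Real.rpow_natCast, ← Real.rpow_natCast,
      ← Real.rpow_mul (by positivity), ← Real.rpow_mul (by positivity), mul_comm]
  calc ∑ a ∈ W, f a = ∑ a ∈ W, ∏ p : P, f p.1 ^ φ a p := Finset.sum_congr rfl hfmul
    _ = ∑ x ∈ W.image φ, ∏ p : P, f p.1 ^ x p := by rw [Finset.sum_image hinj]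
    _ ≤ ∑ x ∈ Fintype.piFinset (fun _ : P => Finset.range k), ∏ p : P, f p.1 ^ x p := by
        refine Finset.sum_le_sum_of_subset_of_nonneg ?_
          (fun _ _ _ => Finset.prod_nonneg fun p _ => pow_nonneg (hf0 _) _)
        intro x hx
        obtain ⟨a, ha, rfl⟩ := Finset.mem_image.1 hx
        exact Fintype.mem_piFinset.2 fun p => Finset.mem_range.2 (hk a ha p)
    _ = ∏ p : P, ∑ j ∈ Finset.range k, f p.1 ^ j := by
        rw [Finset.prod_univ_sum]
    _ ≤ ∏ p : P, Real.exp (4 * f p.1) := by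
        refine Finset.prod_le_prod (fun p _ => Finset.sum_nonneg fun _ _ => pow_nonneg (hf0 _) _)
          fun p _ => ?_
        have h1 := hσ p.1 p.2
        have h0 := hf0 p.1
        change f p.1 ≤ 3 / 4 at h1
        set u := f p.1
        have hg : (∑ j ∈ Finset.range k, u ^ j) * (1 - u) = 1 - u ^ k := geom_sum_mul_neg u k
        have hk0 : 0 ≤ u ^ k := pow_nonneg h0 k
        have h2 : ∑ j ∈ Finset.range k, u ^ j ≤ 1 + 4 * u := by
          have h3 : (∑ j ∈ Finset.range k, u ^ j) * (1 - u) ≤ (1 + 4 * u) * (1 - u) := by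
            rw [hg]; nlinarith
          exact le_of_mul_le_mul_right h3 (by linarith)
        have := Real.add_one_le_exp (4 * u)
        linarith
    _ = Real.exp (4 * ∑ p ∈ P, f p) := by
        rw [← Real.exp_sum, Finset.mul_sum, Finset.sum_coe_sort P (fun p => 4 * f p)]

open Classical in
/-- nonzero primes of norm at most `y`. -/
def prLe (y : ℝ) : Finset (Ideal (𝓞 K)) := (nzI K y).filter fun p => p.IsPrime

theorem prime_sum_le {l : ℝ} (hl : 2 ≤ l) :
    ∑ p ∈ prLe K (Real.exp l), (absNorm p : ℝ) ^ (-(1 - 1 / l)) ≤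
      3 * (Module.finrank ℚ K : ℝ) * (1 + l) := by
  classical
  set n := Module.finrank ℚ K
  set N := ⌊Real.exp l⌋₊
  have hN : 1 ≤ N := (Nat.one_le_floor_iff _).2 (Real.one_le_exp (by linarith))
  have hmaps : ∀ p ∈ prLe K (Real.exp l), absNorm p ∈ Finset.Icc 1 N := by
    intro p hp
    simp only [prLe, Finset.mem_filter, mem_nzI] at hp
    exact Finset.mem_Icc.2 ⟨one_le_absNorm K hp.1.1, Nat.le_floor hp.1.2⟩
  rw [← Finset.sum_fiberwise_of_maps_to hmaps]
  calc _ ≤ ∑ m ∈ Finset.Icc 1 N, 3 * (n : ℝ) * ((m : ℝ)⁻¹) := by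
        refine Finset.sum_le_sum fun m hm => ?_
        rw [Finset.mem_Icc] at hm
        have hm0 : (0 : ℝ) < m := by exact_mod_cast hm.1
        have hmy : (m : ℝ) ≤ Real.exp l := (Nat.le_floor_iff (by positivity)).1 hm.2
        have hlog : Real.log m ≤ l := by
          rw [Real.log_le_iff_le_exp hm0]; exact hmy
        have hpow : (m : ℝ) ^ (-(1 - 1 / l)) ≤ 3 * (m : ℝ)⁻¹ := by
          have e1 : -(1 - 1 / l) = -1 + 1 / l := by ring
          rw [e1, Real.rpow_add hm0, Real.rpow_neg_one, mul_comm]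
          refine mul_le_mul_of_nonneg_right ?_ (by positivity)
          rw [Real.rpow_def_of_pos hm0]
          have : Real.log m * (1 / l) ≤ 1 := by
            rw [mul_one_div, div_le_one (by linarith)]; exact hlog
          refine (Real.exp_le_exp.2 this).trans ?_
          linarith [Real.exp_one_lt_d9]
        refine (Finset.sum_le_card_nsmul _ _ (3 * (m : ℝ)⁻¹) ?_).trans ?_
        · intro p hp
          rw [(Finset.mem_filter.1 hp).2]
          exact hpow
        · rw [nsmul_eq_mul]
          have : #{p ∈ prLe K (Real.exp l) | absNorm p = m} ≤ n := by
            refine (Finset.card_le_card ?_).trans (card_prF_le K m)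
            intro p hp
            simp only [prLe, Finset.mem_filter, mem_nzI] at hp
            exact (mem_prF K).2 ⟨hp.1.1.1, hp.1.2, hp.2⟩
          have h2 : (#{p ∈ prLe K (Real.exp l) | absNorm p = m} : ℝ) ≤ n := by exact_mod_cast this
          calc _ ≤ (n : ℝ) * (3 * (m : ℝ)⁻¹) := by gcongr
            _ = _ := by ring
    _ = 3 * (n : ℝ) * ∑ m ∈ Finset.Icc 1 N, (m : ℝ)⁻¹ := by rw [Finset.mul_sum]
    _ ≤ _ := by
        refine mul_le_mul_of_nonneg_left ?_ (by positivity)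
        have h := harmonic_le_one_add_log N
        rw [harmonic_eq_sum_Icc] at h
        push_cast at h
        refine h.trans ?_
        have : Real.log N ≤ l := by
          rw [Real.log_le_iff_le_exp (by exact_mod_cast hN)]
          exact Nat.floor_le (by positivity)
        linarith

open Classical in
theorem card_smooth_le {X l : ℝ} (hX : 1 ≤ X) (hl : 2 ≤ l) :
    (((nzI K X).filter fun a => (maxNorm K a : ℝ) ≤ Real.exp l).card : ℝ) ≤
      X ^ (1 - 1 / l) * Real.exp (12 * (Module.finrank ℚ K : ℝ) * (1 + l)) := by
  set σ := 1 - 1 / l with hσ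
  have hσ2 : 1 / 2 ≤ σ := by
    have : 1 / l ≤ 1 / 2 := one_div_le_one_div_of_le (by norm_num) hl
    linarith
  set W := (nzI K X).filter fun a => (maxNorm K a : ℝ) ≤ Real.exp l with hWdef
  have hW : ∀ a ∈ W, a ≠ ⊥ ∧ (absNorm a : ℝ) ≤ X ∧ (maxNorm K a : ℝ) ≤ Real.exp l := by
    intro a ha
    simp only [hWdef, Finset.mem_filter, mem_nzI] at ha
    exact ⟨ha.1.1, ha.1.2, ha.2⟩
  have h1 := smooth_sum_le K W (prLe K (Real.exp l)) (fun a ha => (hW a ha).1)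
    (fun p hp => by
      simp only [prLe, Finset.mem_filter, mem_nzI] at hp
      exact ⟨hp.1.1, hp.2⟩)
    (fun a ha p hp hap => by
      simp only [prLe, Finset.mem_filter, mem_nzI]
      refine ⟨⟨ne_bot_of_le K (hW a ha).1 hap, le_trans ?_ (hW a ha).2.2⟩, hp⟩
      exact_mod_cast le_maxNorm K (hW a ha).1 hp hap)
    σ
    (fun p hp => by
      simp only [prLe, Finset.mem_filter, mem_nzI] at hp
      have h2 : (2 : ℝ) ≤ absNorm p := by exact_mod_cast two_le_absNorm K hp.2 hp.1.1
      calc (absNorm p : ℝ) ^ (-σ) ≤ (2 : ℝ) ^ (-σ) :=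
            Real.rpow_le_rpow_of_nonpos (by norm_num) h2 (by linarith)
        _ ≤ (2 : ℝ) ^ (-(1 / 2) : ℝ) :=
            Real.rpow_le_rpow_of_exponent_le (by norm_num) (by linarith)
        _ ≤ 3 / 4 := by
            rw [Real.rpow_neg (by norm_num), ← Real.sqrt_eq_rpow]
            rw [inv_le_comm₀ (by positivity) (by norm_num)]
            refine Real.le_sqrt_of_sq_le (by norm_num))
  have h2 := prime_sum_le K hl
  calc (W.card : ℝ) = ∑ a ∈ W, (1 : ℝ) := by simp
    _ ≤ ∑ a ∈ W, X ^ σ * (absNorm a : ℝ) ^ (-σ) := by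
        refine Finset.sum_le_sum fun a ha => ?_
        have ha0 : (0 : ℝ) < absNorm a := by exact_mod_cast one_le_absNorm K (hW a ha).1
        rw [Real.rpow_neg ha0.le, ← div_eq_mul_inv, le_div_iff₀ (by positivity), one_mul]
        exact Real.rpow_le_rpow ha0.le (hW a ha).2.1 (by linarith)
    _ = X ^ σ * ∑ a ∈ W, (absNorm a : ℝ) ^ (-σ) := by rw [Finset.mul_sum]
    _ ≤ _ := by
        refine mul_le_mul_of_nonneg_left (h1.trans (Real.exp_le_exp.2 ?_)) (by positivity)
        linarith

theorem tsum_QS_eq {X : ℝ} (hX : 1 ≤ X) :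
    ∃ R : ℝ, (∑' a : {a : Ideal (𝓞 K) // 2 ≤ absNorm a ∧ (absNorm a : ℝ) ≤ X},
          (QS K Set.univ a.1 : ℝ)) = (idealCount K X : ℝ) - 1 + R ∧ 0 ≤ R ∧
      R ≤ (Module.finrank ℚ K : ℝ) * idealCount K X ∧
      ∀ y : ℝ, R ≤ (Module.finrank ℚ K : ℝ) *
        (Nat.card {a : Ideal (𝓞 K) // a ∈ nzI K X ∧ (maxNorm K a : ℝ) ≤ y} +
         Nat.card {a : Ideal (𝓞 K) // a ∈ nzI K X ∧ y < maxNorm K a ∧ 2 ≤ QS K Set.univ a}) := by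
  classical
  set n := Module.finrank ℚ K
  set F := (nzI K X).erase ⊤ with hF
  have hFm : ∀ a, a ∈ F ↔ a ≠ ⊤ ∧ a ≠ ⊥ ∧ (absNorm a : ℝ) ≤ X := by
    intro a; rw [hF, Finset.mem_erase, mem_nzI]
  have hmem : ∀ a : Ideal (𝓞 K), (2 ≤ absNorm a ∧ (absNorm a : ℝ) ≤ X) ↔ a ∈ F := by
    intro a
    rw [hFm]
    constructor
    · rintro ⟨h1, h2⟩
      refine ⟨?_, ?_, h2⟩
      · rintro rfl; simp at h1
      · rintro rfl; simp at h1
    · rintro ⟨h1, h2, h3⟩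
      refine ⟨?_, h3⟩
      have := one_le_absNorm K h2
      have : absNorm a ≠ 1 := fun h => h1 (absNorm_eq_one_iff.1 h)
      omega
  have htop : (⊤ : Ideal (𝓞 K)) ∈ nzI K X := by
    rw [mem_nzI]; exact ⟨top_ne_bot, by simpa using hX⟩
  have hcard : (F.card : ℝ) = (idealCount K X : ℝ) - 1 := by
    rw [← card_nzI, ← Finset.card_erase_add_one htop]; push_cast; ring
  have hts : (∑' a : {a : Ideal (𝓞 K) // 2 ≤ absNorm a ∧ (absNorm a : ℝ) ≤ X},
          (QS K Set.univ a.1 : ℝ)) = ∑ a ∈ F, (QS K Set.univ a : ℝ) := by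
    rw [← Finset.tsum_subtype F (fun a => (QS K Set.univ a : ℝ))]
    exact (Equiv.subtypeEquivRight hmem).tsum_eq
      (fun a : {a // a ∈ F} => (QS K Set.univ a.1 : ℝ))
  have h1 : ∀ a ∈ F, (1 : ℝ) ≤ QS K Set.univ a := fun a ha => by
    exact_mod_cast one_le_QS K ((hFm a).1 ha).2.1 ((hFm a).1 ha).1
  have h2 : ∀ a ∈ F, (QS K Set.univ a : ℝ) ≤ n := fun a ha => by
    exact_mod_cast QS_le K ((hFm a).1 ha).2.1
  refine ⟨∑ a ∈ F, ((QS K Set.univ a : ℝ) - 1), ?_, ?_, ?_, ?_⟩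
  · rw [hts, Finset.sum_sub_distrib, ← hcard]; simp
  · exact Finset.sum_nonneg fun a ha => by linarith [h1 a ha]
  · refine (Finset.sum_le_card_nsmul _ _ (n : ℝ) (fun a ha => by linarith [h2 a ha])).trans ?_
    rw [nsmul_eq_mul, hcard, mul_comm]
    gcongr
    linarith
  · intro y
    rw [Nat.subtype_card ((nzI K X).filter fun a => (maxNorm K a : ℝ) ≤ y)
        (fun x => Finset.mem_filter),
      Nat.subtype_card ((nzI K X).filter fun a => y < maxNorm K a ∧ 2 ≤ QS K Set.univ a)
        (fun x => Finset.mem_filter)]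
    set A := (nzI K X).filter fun a => (maxNorm K a : ℝ) ≤ y with hA
    set B := (nzI K X).filter fun a => y < maxNorm K a ∧ 2 ≤ QS K Set.univ a with hB
    calc ∑ a ∈ F, ((QS K Set.univ a : ℝ) - 1)
        ≤ ∑ a ∈ F, if a ∈ A ∪ B then (n : ℝ) else 0 := by
          refine Finset.sum_le_sum fun a ha => ?_
          split_ifs with h
          · linarith [h2 a ha]
          · have : ¬ 2 ≤ QS K Set.univ a := by
              intro hq
              apply h
              have : a ∈ nzI K X := Finset.mem_of_mem_erase ha
              rw [Finset.mem_union, hA, hB, Finset.mem_filter, Finset.mem_filter]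
              rcases le_or_gt (maxNorm K a : ℝ) y with h' | h'
              · exact Or.inl ⟨this, h'⟩
              · exact Or.inr ⟨this, h', hq⟩
            have h3 : (QS K Set.univ a : ℝ) ≤ 1 := by
              exact_mod_cast (by omega : QS K Set.univ a ≤ 1)
            linarith
      _ = ((F ∩ (A ∪ B)).card : ℝ) * n := by
          rw [Finset.sum_ite_mem, Finset.sum_const, nsmul_eq_mul]
      _ ≤ ((A.card + B.card : ℕ) : ℝ) * n := by
          gcongr
          exact (Finset.card_le_card Finset.inter_subset_right).trans (Finset.card_union_le _ _)
      _ = _ := by push_cast; ring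

theorem R_le : ∃ C : ℝ, 0 ≤ C ∧ ∀ X l : ℝ, 1 ≤ X → 2 ≤ l → l ^ 3 = Real.log X →
    (Module.finrank ℚ K : ℝ) *
        (Nat.card {a : Ideal (𝓞 K) // a ∈ nzI K X ∧ (maxNorm K a : ℝ) ≤ Real.exp l} +
         Nat.card {a : Ideal (𝓞 K) // a ∈ nzI K X ∧ Real.exp l < maxNorm K a ∧
          2 ≤ QS K Set.univ a}) ≤ C * X * Real.exp (-l) := by
  classical
  obtain ⟨C₁, hC₁, h⟩ := card_nzI_le K
  set n : ℝ := (Module.finrank ℚ K : ℝ)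
  have hn : 0 ≤ n := Nat.cast_nonneg _
  set B : ℝ := 12 * n + (12 * n + 1) ^ 2
  refine ⟨n * (Real.exp B + n ^ 2 * C₁ * 2), by positivity, fun X l hX hl hlX => ?_⟩
  have hX0 : 0 < X := by linarith
  rw [Nat.subtype_card ((nzI K X).filter fun a => (maxNorm K a : ℝ) ≤ Real.exp l)
        (fun x => Finset.mem_filter),
      Nat.subtype_card ((nzI K X).filter fun a => Real.exp l < maxNorm K a ∧ 2 ≤ QS K Set.univ a)
        (fun x => Finset.mem_filter)]
  have h1 := card_smooth_le K hX hl
  have h2 := card_double_le K hC₁ h hX0.le (Real.one_le_exp (by linarith : 0 ≤ l))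
  have h3 : X ^ (1 - 1 / l) * Real.exp (12 * n * (1 + l)) ≤ Real.exp B * X * Real.exp (-l) := by
    rw [Real.rpow_def_of_pos hX0, ← hlX]
    have hXe : X = Real.exp (l ^ 3) := by rw [hlX, Real.exp_log hX0]
    conv_rhs => rw [hXe]
    rw [← Real.exp_add, ← Real.exp_add, ← Real.exp_add]
    apply Real.exp_le_exp.2
    have : l ^ 3 * (1 - 1 / l) = l ^ 3 - l ^ 2 := by
      have : l ≠ 0 := by linarith
      field_simp
    rw [this]
    simp only [B]
    nlinarith [sq_nonneg (l - (12 * n + 1)), mul_nonneg hn (by linarith : 0 ≤ l)]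
  have h4 : 2 / Real.exp l = 2 * Real.exp (-l) := by rw [Real.exp_neg]; rfl
  rw [h4] at h2
  calc _ ≤ n * (Real.exp B * X * Real.exp (-l) + n ^ 2 * C₁ * X * (2 * Real.exp (-l))) := by
        gcongr
        exact h1.trans h3
    _ = _ := by ring

theorem pow_save {n : ℝ} (hn : 1 ≤ n) {X l : ℝ} (hX : 1 ≤ X) (hl : 0 ≤ l)
    (hlX : l ^ 3 = Real.log X) :
    X ^ (1 - 1 / (3 * n)) ≤ Real.exp (3 * n) * X * Real.exp (-l) := by
  have hX0 : 0 < X := by linarith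
  rw [Real.rpow_def_of_pos hX0, ← hlX]
  have hXe : X = Real.exp (l ^ 3) := by rw [hlX, Real.exp_log hX0]
  conv_rhs => rw [hXe]
  rw [← Real.exp_add, ← Real.exp_add]
  apply Real.exp_le_exp.2
  have : l ≤ 3 * n + l ^ 3 / (3 * n) := by
    rcases le_or_gt l (3 * n) with h | h
    · have : 0 ≤ l ^ 3 / (3 * n) := by positivity
      linarith
    · have : l ≤ l ^ 3 / (3 * n) := by
        rw [le_div_iff₀ (by positivity)]
        have : 3 * n ≤ l ^ 2 := by nlinarith
        nlinarith
      linarith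
  have e : l ^ 3 * (1 - 1 / (3 * n)) = l ^ 3 - l ^ 3 / (3 * n) := by ring
  rw [e]; linarith

end qsum

/-- `∑_{2 ≤ N(a) ≤ X} Q(a) = c_K X + O(X exp(-C (log X)^{1/3}))`. -/
theorem q_sum_asymptotic :
    ∃ C : ℝ, 0 < C ∧ ∃ C' : ℝ, 0 < C' ∧ ∀ X : ℝ, 1 ≤ X →
      |(∑' a : {a : Ideal (𝓞 K) // 2 ≤ absNorm a ∧ (absNorm a : ℝ) ≤ X},
          (QS K Set.univ a.1 : ℝ)) - cK K * X| ≤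
        C' * X * Real.exp (-C * Real.log X ^ ((1 : ℝ) / 3)) := by
  obtain ⟨C₀, hC₀, h₀⟩ := ideal_count_asymp K
  obtain ⟨C₁, hC₁, h₁⟩ := card_nzI_le K
  obtain ⟨C₂, hC₂, h₂⟩ := R_le K
  set n : ℝ := (Module.finrank ℚ K : ℝ) with hn
  have hn1 : 1 ≤ n := by
    rw [hn]; exact_mod_cast (Module.finrank_pos (R := ℚ) (M := K))
  refine ⟨1, one_pos, C₀ * Real.exp (3 * n) + Real.exp 3 + (C₂ + n * C₁ * Real.exp 2),
    by positivity, fun X hX => ?_⟩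
  have hX0 : 0 < X := by linarith
  set l := Real.log X ^ ((1 : ℝ) / 3) with hl
  have hL : 0 ≤ Real.log X := Real.log_nonneg hX
  have hl0 : 0 ≤ l := by positivity
  have hl3 : l ^ 3 = Real.log X := by
    rw [hl, ← Real.rpow_natCast, ← Real.rpow_mul hL]; norm_num
  obtain ⟨R, hR, hR0, hR1, hR2⟩ := tsum_QS_eq K hX
  rw [hR, neg_one_mul]
  have hcount := h₀ X hX
  have hps := mul_le_mul_of_nonneg_left (pow_save hn1 hX hl0 hl3) hC₀
  have h1 : 1 ≤ Real.exp 3 * X * Real.exp (-l) := by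
    have := pow_save le_rfl hX hl0 hl3
    refine le_trans (Real.one_le_rpow hX (by norm_num)) (this.trans (le_of_eq (by norm_num)))
  have hRle : R ≤ (C₂ + n * C₁ * Real.exp 2) * X * Real.exp (-l) := by
    have hsplit : (C₂ + n * C₁ * Real.exp 2) * X * Real.exp (-l) =
      C₂ * X * Real.exp (-l) + n * C₁ * X * (Real.exp 2 * Real.exp (-l)) := by ring
    rw [hsplit, ← Real.exp_add]
    rcases le_or_gt 2 l with h | h
    · have hb := (hR2 (Real.exp l)).trans (h₂ X l hX h hl3)
      have : 0 ≤ n * C₁ * X * Real.exp (2 + -l) := by positivity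
      linarith
    · have hb := h₁ X hX0.le
      rw [card_nzI] at hb
      have hb2 : R ≤ n * (C₁ * X) := hR1.trans (mul_le_mul_of_nonneg_left hb (by linarith))
      have h3 : n * C₁ * X * 1 ≤ n * C₁ * X * Real.exp (2 + -l) :=
        mul_le_mul_of_nonneg_left (Real.one_le_exp (by linarith)) (by positivity)
      have : 0 ≤ C₂ * X * Real.exp (-l) := by positivity
      linarith
  rw [abs_le] at hcount ⊢
  constructor <;> nlinarith

end AlladiGen
end
end

section
/- Let K be a number field. For X ≥ 1, Σ_{N(a) ≤ X} 1/N(a) = c_K·log X + O(1), where the sum runs over nonzero integral ideals a of O_K of norm at most X and the implied constant depends only on K. -/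
open NumberField Ideal Filter

noncomputable section

namespace AlladiGen

variable (K : Type*) [Field K] [NumberField K]

section Helpers

/-- Integer vectors split as twice an integer vector plus a 0-1 vector. -/
def splitEquiv (ι : Type*) : (ι → ℤ) ≃ (ι → ℤ) × (ι → Fin 2) :=
  (Equiv.arrowCongr (Equiv.refl ι) (Int.divModEquiv 2)).trans
    (Equiv.arrowProdEquivProdArrow ι (fun _ => ℤ) (fun _ => Fin 2))

lemma splitEquiv_symm_apply {ι : Type*} (q : ι → ℤ) (r : ι → Fin 2) (i : ι) :
    (splitEquiv ι).symm (q, r) i = q i * 2 + (r i : ℕ) := rfl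

/-- The box of integer vectors with entries bounded by `R * 2 ^ k`. -/
def zbox (ι : Type*) [Fintype ι] (R : ℝ) (k : ℕ) : Finset (ι → ℤ) :=
  haveI := Classical.decEq ι
  Fintype.piFinset (fun _ => Finset.Icc (-⌊R * 2 ^ k⌋) ⌊R * 2 ^ k⌋)

lemma mem_zbox {ι : Type*} [Fintype ι] {R : ℝ} (hR : 0 ≤ R) {k : ℕ} {m : ι → ℤ}
    (h : ‖(fun i => (m i : ℝ) / 2 ^ k : ι → ℝ)‖ ≤ R) : m ∈ zbox ι R k := by
  classical
  rw [pi_norm_le_iff_of_nonneg hR] at h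
  rw [zbox]
  simp only [Fintype.mem_piFinset, Finset.mem_Icc]
  intro i
  have := h i
  rw [norm_div, norm_pow, Real.norm_ofNat, div_le_iff₀ (by positivity), Real.norm_eq_abs,
    abs_le] at this
  constructor
  · rw [neg_le, Int.le_floor]; push_cast; linarith
  · rw [Int.le_floor]; exact this.2

lemma card_zbox_le {ι : Type*} [Fintype ι] {R : ℝ} (hR : 0 ≤ R) (k : ℕ) :
    ((zbox ι R k).card : ℝ) ≤ ((2 * R + 1) * 2 ^ k) ^ Fintype.card ι := by
  classical
  have h0 : 0 ≤ R * 2 ^ k := by positivity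
  have h1 : (0 : ℤ) ≤ ⌊R * 2 ^ k⌋ := Int.floor_nonneg.2 h0
  have h2 : (1 : ℝ) ≤ 2 ^ k := one_le_pow₀ (by norm_num)
  rw [zbox, Fintype.card_piFinset]
  simp only [Int.card_Icc, Finset.prod_const, Finset.card_univ]
  push_cast
  gcongr
  have h3 : (((⌊R * 2 ^ k⌋ + 1 - -⌊R * 2 ^ k⌋).toNat : ℤ) : ℝ) = 2 * (⌊R * 2 ^ k⌋ : ℝ) + 1 := by
    rw [Int.toNat_of_nonneg (by lia)]; push_cast; ring
  rw [Int.cast_natCast] at h3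
  rw [h3]
  have := Int.floor_le (R * 2 ^ k)
  nlinarith

lemma summable_lattice {ι : Type*} [Fintype ι] {f : (ι → ℝ) → ℝ} {R : ℝ} (hR0 : 0 ≤ R)
    (hR : ∀ x, f x ≠ 0 → ‖x‖ ≤ R) (k : ℕ) :
    Summable (fun m : ι → ℤ => f (fun i => (m i : ℝ) / 2 ^ k)) :=
  summable_of_ne_finset_zero (s := zbox ι R k) (fun m hm => by
    by_contra h
    exact hm (mem_zbox hR0 (hR _ h)))

lemma lattice_step {ι : Type*} [Fintype ι] {f : (ι → ℝ) → ℝ} {L R : ℝ}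
    (hL0 : 0 ≤ L) (hR0 : 0 ≤ R) (hL : ∀ x y, |f x - f y| ≤ L * ‖x - y‖)
    (hR : ∀ x, f x ≠ 0 → ‖x‖ ≤ R) (k : ℕ) :
    |(∑' m : ι → ℤ, f (fun i => (m i : ℝ) / 2 ^ (k + 1)))
      - 2 ^ Fintype.card ι * ∑' m : ι → ℤ, f (fun i => (m i : ℝ) / 2 ^ k)|
      ≤ ((2 * (R + 1) + 1) * 2 ^ k) ^ Fintype.card ι * (2 ^ Fintype.card ι * (L * (1 / 2) ^ k)) := by
  classical
  set F : (ι → ℤ) → (ι → Fin 2) → ℝ := fun q r =>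
    f (fun i => ((q i : ℝ) * 2 + ((r i : ℕ) : ℝ)) / 2 ^ (k + 1)) with hF
  have hs := summable_lattice hR0 hR (k + 1)
  have hs' : Summable (fun p : (ι → ℤ) × (ι → Fin 2) => F p.1 p.2) := by
    refine ((splitEquiv ι).symm.summable_iff.2 hs).congr ?_
    rintro ⟨q, r⟩
    simp [hF, splitEquiv_symm_apply]
  have e1 : (∑' m : ι → ℤ, f (fun i => (m i : ℝ) / 2 ^ (k + 1))) = ∑' q, ∑ r, F q r := by
    rw [← (splitEquiv ι).symm.tsum_eq]
    have : ∀ p : (ι → ℤ) × (ι → Fin 2),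
        f (fun i => (((splitEquiv ι).symm p i : ℤ) : ℝ) / 2 ^ (k + 1)) = F p.1 p.2 := by
      rintro ⟨q, r⟩
      simp [hF, splitEquiv_symm_apply]
    simp_rw [this]
    rw [hs'.tsum_prod]
    simp_rw [tsum_fintype]
  have hdist : ∀ (q : ι → ℤ) (r : ι → Fin 2), ‖(fun i => ((q i : ℝ) * 2 + ((r i : ℕ) : ℝ)) / 2 ^ (k + 1) : ι → ℝ) -
      (fun i => (q i : ℝ) / 2 ^ k)‖ ≤ (1 / 2) ^ k := by
    intro q r
    rw [pi_norm_le_iff_of_nonneg (by positivity)]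
    intro i
    have : ((q i : ℝ) * 2 + ((r i : ℕ) : ℝ)) / 2 ^ (k + 1) - (q i : ℝ) / 2 ^ k
        = ((r i : ℕ) : ℝ) / 2 * (1 / 2) ^ k := by
      rw [pow_succ, one_div, inv_pow]; field_simp; ring
    rw [Pi.sub_apply, this, Real.norm_eq_abs, abs_of_nonneg (by positivity)]
    have h2 : ((r i : ℕ) : ℝ) ≤ 1 := by
      have := (r i).2
      exact_mod_cast (by omega : (r i : ℕ) ≤ 1)
    have : ((r i : ℕ) : ℝ) / 2 ≤ 1 := by linarith
    exact mul_le_of_le_one_left (by positivity) this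
  have hzero1 : ∀ q, q ∉ zbox ι (R + 1) k → ∀ r, F q r = 0 := by
    intro q hq r
    by_contra h
    have h1 := hR _ h
    apply hq
    apply mem_zbox (by linarith)
    have h2 := hdist q r
    have h3 : ((1 : ℝ) / 2) ^ k ≤ 1 := pow_le_one₀ (by norm_num) (by norm_num)
    have := norm_sub_norm_le (fun i => (q i : ℝ) / 2 ^ k : ι → ℝ)
      (fun i => ((q i : ℝ) * 2 + ((r i : ℕ) : ℝ)) / 2 ^ (k + 1))
    rw [norm_sub_rev] at this
    linarith
  have hzero2 : ∀ q, q ∉ zbox ι (R + 1) k → f (fun i => (q i : ℝ) / 2 ^ k) = 0 := by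
    intro q hq
    by_contra h
    exact hq (mem_zbox (by linarith) ((hR _ h).trans (by linarith)))
  rw [e1, tsum_eq_sum (s := zbox ι (R + 1) k) (fun q hq => Finset.sum_eq_zero
      (fun r _ => hzero1 q hq r)), tsum_eq_sum (s := zbox ι (R + 1) k) (hzero2), Finset.mul_sum,
      ← Finset.sum_sub_distrib]
  refine (Finset.abs_sum_le_sum_abs _ _).trans ?_
  refine (Finset.sum_le_card_nsmul _ _ (2 ^ Fintype.card ι * (L * (1 / 2) ^ k)) ?_).trans ?_
  · intro q _
    have : ∑ r, F q r - 2 ^ Fintype.card ι * f (fun i => (q i : ℝ) / 2 ^ k)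
        = ∑ r : ι → Fin 2, (F q r - f (fun i => (q i : ℝ) / 2 ^ k)) := by
      rw [Finset.sum_sub_distrib]; simp
    rw [this]
    refine (Finset.abs_sum_le_sum_abs _ _).trans ?_
    refine (Finset.sum_le_card_nsmul _ _ (L * (1 / 2) ^ k) ?_).trans ?_
    · intro r _
      exact (hL _ _).trans (mul_le_mul_of_nonneg_left (hdist q r) hL0)
    · simp
  · rw [nsmul_eq_mul]
    gcongr
    exact card_zbox_le (by linarith) k

lemma lattice_sum {ι : Type*} [Fintype ι] {f : (ι → ℝ) → ℝ} {L R : ℝ}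
    (hL0 : 0 ≤ L) (hR0 : 0 ≤ R) (hL : ∀ x y, |f x - f y| ≤ L * ‖x - y‖)
    (hR : ∀ x, f x ≠ 0 → ‖x‖ ≤ R) :
    ∃ κ C : ℝ, ∀ k : ℕ, |((2 ^ Fintype.card ι) ^ k)⁻¹ *
      (∑' m : ι → ℤ, f (fun i => (m i : ℝ) / 2 ^ k)) - κ| ≤ C * (1 / 2) ^ k := by
  set S : ℕ → ℝ := fun k => ((2 ^ Fintype.card ι) ^ k)⁻¹ *
      (∑' m : ι → ℤ, f (fun i => (m i : ℝ) / 2 ^ k)) with hS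
  set C : ℝ := (2 * (R + 1) + 1) ^ Fintype.card ι * L with hC
  have hstep : ∀ k, dist (S k) (S (k + 1)) ≤ C * (1 / 2) ^ k := by
    intro k
    have h := lattice_step hL0 hR0 hL hR k
    have hp : (0 : ℝ) < (2 ^ Fintype.card ι) ^ (k + 1) := by positivity
    rw [dist_comm, Real.dist_eq]
    have e : S (k + 1) - S k = ((2 ^ Fintype.card ι) ^ (k + 1))⁻¹ *
      ((∑' m : ι → ℤ, f (fun i => (m i : ℝ) / 2 ^ (k + 1)))
      - 2 ^ Fintype.card ι * ∑' m : ι → ℤ, f (fun i => (m i : ℝ) / 2 ^ k)) := by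
      simp only [hS]
      rw [pow_succ (2 ^ Fintype.card ι : ℝ) k]
      field_simp
    rw [e, abs_mul, abs_of_pos (inv_pos.2 hp), inv_mul_le_iff₀ hp]
    refine h.trans (le_of_eq ?_)
    rw [hC, mul_pow, ← pow_mul, mul_comm k, pow_mul, pow_succ (2 ^ Fintype.card ι : ℝ) k]
    ring
  obtain ⟨κ, hκ⟩ := cauchySeq_tendsto_of_complete
    (cauchySeq_of_le_geometric (1 / 2) C (by norm_num) hstep)
  refine ⟨κ, C * 2, fun k => ?_⟩
  have := dist_le_of_le_geometric_of_tendsto (1 / 2) C (by norm_num) hstep hκ k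
  rw [Real.dist_eq] at this
  refine this.trans (le_of_eq ?_)
  ring

/-- A smooth bump whose integer translates sum to one. -/
def bump (x : ℝ) : ℝ := Real.smoothTransition (x + 1) - Real.smoothTransition x

lemma bump_contDiff : ContDiff ℝ 1 bump := by
  have h : ContDiff ℝ 1 Real.smoothTransition := Real.smoothTransition.contDiff (n := 1)
  exact (h.comp (contDiff_id.add contDiff_const)).sub h

lemma bump_eq_zero {x : ℝ} (h : 1 ≤ |x|) : bump x = 0 := by
  unfold bump
  rcases le_abs.1 h with h | h
  · rw [Real.smoothTransition.one_of_one_le h, Real.smoothTransition.one_of_one_le (by linarith),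
      sub_self]
  · rw [Real.smoothTransition.zero_of_nonpos (by linarith),
      Real.smoothTransition.zero_of_nonpos (by linarith), sub_self]

lemma bump_sum_pair (x : ℝ) :
    ∑ e ∈ ({⌊-x⌋, ⌊-x⌋ + 1} : Finset ℤ), bump (x + e) = 1 := by
  rw [Finset.sum_pair (by lia)]
  have h1 := Int.floor_le (-x)
  have h2 := Int.lt_floor_add_one (-x)
  unfold bump
  push_cast
  rw [Real.smoothTransition.zero_of_nonpos (x := x + ⌊-x⌋) (by linarith),
    Real.smoothTransition.one_of_one_le (x := x + (⌊-x⌋ + 1) + 1) (by linarith),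
    ← add_assoc x]
  ring

lemma bump_zero_of_not_mem (x : ℝ) (e : ℤ) (he : e ∉ ({⌊-x⌋, ⌊-x⌋ + 1} : Finset ℤ)) :
    bump (x + e) = 0 := by
  apply bump_eq_zero
  simp only [Finset.mem_insert, Finset.mem_singleton, not_or] at he
  have h1 := Int.floor_le (-x)
  have h2 := Int.lt_floor_add_one (-x)
  rcases lt_or_ge e ⌊-x⌋ with h | h
  · have h3 : (e : ℝ) + 1 ≤ ⌊-x⌋ := by exact_mod_cast h
    rw [le_abs]; right; linarith
  · have h3 : ((⌊-x⌋ : ℤ) : ℝ) + 2 ≤ e := by exact_mod_cast (by lia : ⌊-x⌋ + 2 ≤ e)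
    rw [le_abs]; left; linarith

lemma hasSum_bump_pi {ρ : Type*} [Fintype ρ] (x : ρ → ℝ) :
    HasSum (fun e : ρ → ℤ => ∏ i, bump (x i + e i)) 1 := by
  classical
  have h : ∑ e ∈ Fintype.piFinset (fun i => ({⌊-x i⌋, ⌊-x i⌋ + 1} : Finset ℤ)),
      ∏ i, bump (x i + e i) = 1 := by
    rw [← Finset.prod_univ_sum (fun i => ({⌊-x i⌋, ⌊-x i⌋ + 1} : Finset ℤ))
      (fun i (j : ℤ) => bump (x i + j))]
    exact Finset.prod_eq_one (fun i _ => bump_sum_pair (x i))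
  rw [← h]
  apply hasSum_sum_of_ne_finset_zero
  intro e he
  simp only [Fintype.mem_piFinset, not_forall] at he
  obtain ⟨i, hi⟩ := he
  exact Finset.prod_eq_zero (Finset.mem_univ i) (bump_zero_of_not_mem _ _ hi)

lemma bump_sum_range (η : ℝ) (hη : 0 ≤ η) (m : ℕ) :
    ∑ k ∈ Finset.range m, bump (η - k) = 1 - Real.smoothTransition (η - m + 1) := by
  induction m with
  | zero => simp [Real.smoothTransition.one_of_one_le (x := η + 1) (by linarith)]
  | succ m ih =>
    rw [Finset.sum_range_succ, ih, bump]
    push_cast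
    rw [show η - (m + 1) + 1 = η - m by ring]
    ring

open mixedEmbedding NumberField.InfinitePlace NumberField.Units

/-- Logarithmic coordinates with respect to the complete basis. -/
def lcoord (x : mixedSpace K) : InfinitePlace K → ℝ :=
  (fundamentalCone.completeBasis K).equivFun
    (fun w => (mult w : ℝ) * Real.log (normAtPlace w x))

open Classical in
/-- The weight in logarithmic coordinates. -/
def wtF (ξ : InfinitePlace K → ℝ) : ℝ :=
  Real.exp (-(Module.finrank ℚ K * ξ dirichletUnitTheorem.w₀)) *
    bump (ξ dirichletUnitTheorem.w₀ / Real.log 2) *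
    ∏ i : {w : InfinitePlace K // w ≠ dirichletUnitTheorem.w₀}, bump (ξ i)

open Classical in
/-- The weight on the mixed space. -/
def gfun (x : mixedSpace K) : ℝ :=
  if ∀ w, normAtPlace w x ≠ 0 then wtF K (lcoord K x) else 0

lemma wtF_contDiff : ContDiff ℝ 1 (wtF K) := by
  unfold wtF
  have := bump_contDiff
  refine ContDiff.mul (ContDiff.mul ?_ ?_) ?_
  · fun_prop
  · exact this.comp (by fun_prop)
  · exact contDiff_prod (fun i _ => this.comp (by fun_prop))

lemma wtF_support {ξ : InfinitePlace K → ℝ} (h : wtF K ξ ≠ 0) (w : InfinitePlace K) :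
    |ξ w| ≤ 1 := by
  by_contra! hw
  apply h
  unfold wtF
  by_cases h0 : w = dirichletUnitTheorem.w₀
  · subst h0
    rw [bump_eq_zero, mul_zero, zero_mul]
    have h1 : 0 < Real.log 2 := Real.log_pos (by norm_num)
    have h2 : Real.log 2 ≤ 1 := by linarith [Real.log_two_lt_d9]
    rw [abs_div, abs_of_pos h1, le_div_iff₀ h1]
    linarith
  · classical
    rw [Finset.prod_eq_zero (f := fun i : {w : InfinitePlace K // w ≠ dirichletUnitTheorem.w₀} =>
      bump (ξ i)) (i := ⟨w, h0⟩) (Finset.mem_univ _) (bump_eq_zero hw.le), mul_zero]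

lemma gfun_support : ∃ a R : ℝ, 0 < a ∧ 0 ≤ R ∧ ∀ x : mixedSpace K, gfun K x ≠ 0 →
    ∀ w, a ≤ normAtPlace w x ∧ normAtPlace w x ≤ R := by
  set T := (fundamentalCone.completeBasis K).equivFunL.symm with hT
  set M : ℝ := ‖(T : (InfinitePlace K → ℝ) →L[ℝ] (realSpace K))‖ with hM
  refine ⟨Real.exp (-M), Real.exp M, Real.exp_pos _, (Real.exp_pos _).le, fun x hx w => ?_⟩
  unfold gfun at hx
  split_ifs at hx with hne
  · have h1 := wtF_support K hx
    have h2 : ‖lcoord K x‖ ≤ 1 := (pi_norm_le_iff_of_nonneg zero_le_one).2 h1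
    have h3 : T (lcoord K x) = (fun w => (mult w : ℝ) * Real.log (normAtPlace w x)) := by
      rw [hT, lcoord]
      exact (fundamentalCone.completeBasis K).equivFun.symm_apply_apply _
    have h4 : ‖(fun w => (mult w : ℝ) * Real.log (normAtPlace w x) : InfinitePlace K → ℝ)‖ ≤ M := by
      rw [← h3]
      have := (T : (InfinitePlace K → ℝ) →L[ℝ] (realSpace K)).le_opNorm_of_le h2
      simpa using this
    have h5 := (norm_le_pi_norm _ w).trans h4
    rw [Real.norm_eq_abs, abs_mul, Nat.abs_cast] at h5
    have h6 : (1 : ℝ) ≤ mult w := by exact_mod_cast one_le_mult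
    have h7 : |Real.log (normAtPlace w x)| ≤ M := by
      refine le_trans ?_ h5
      exact le_mul_of_one_le_left (abs_nonneg _) h6
    have hpos : 0 < normAtPlace w x := lt_of_le_of_ne (normAtPlace_nonneg w x) (hne w).symm
    rw [abs_le] at h7
    rw [← Real.le_log_iff_exp_le hpos, ← Real.log_le_iff_le_exp hpos]
    exact h7
  · exact absurd rfl hx

open scoped Classical in
lemma normAtPlace_contDiffAt (w : InfinitePlace K) (x : mixedSpace K) (h : normAtPlace w x ≠ 0) :
    ContDiffAt ℝ 1 (fun x : mixedSpace K => normAtPlace w x) x := by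
  by_cases hw : IsReal w
  · have e : (fun x : mixedSpace K => normAtPlace w x) = fun x => ‖x.1 ⟨w, hw⟩‖ :=
      funext (fun x => normAtPlace_apply_of_isReal hw x)
    rw [normAtPlace_apply_of_isReal hw, norm_ne_zero_iff] at h
    rw [e]
    exact ContDiffAt.comp x (contDiffAt_norm ℝ h) (by fun_prop)
  · have hw := not_isReal_iff_isComplex.1 hw
    have e : (fun x : mixedSpace K => normAtPlace w x) = fun x => ‖x.2 ⟨w, hw⟩‖ :=
      funext (fun x => normAtPlace_apply_of_isComplex hw x)
    rw [normAtPlace_apply_of_isComplex hw, norm_ne_zero_iff] at h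
    rw [e]
    exact ContDiffAt.comp x (contDiffAt_norm ℂ h) (by fun_prop)

open scoped Classical in
lemma gfun_contDiff : ContDiff ℝ 1 (gfun K) := by
  rw [contDiff_iff_contDiffAt]
  intro x
  by_cases hx : ∀ w, normAtPlace w x ≠ 0
  · have hev : gfun K =ᶠ[nhds x] fun y => wtF K (lcoord K y) := by
      have : ∀ᶠ y in nhds x, ∀ w, normAtPlace w y ≠ 0 := by
        rw [eventually_all]
        exact fun w => (continuous_normAtPlace w).continuousAt.eventually_ne (hx w)
      filter_upwards [this] with y hy
      rw [gfun, if_pos hy]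
    refine ContDiffAt.congr_of_eventuallyEq ?_ hev
    refine (wtF_contDiff K).contDiffAt.comp x ?_
    unfold lcoord
    refine ((fundamentalCone.completeBasis K).equivFunL.contDiff.contDiffAt).comp x ?_
    rw [contDiffAt_pi]
    intro w
    exact contDiffAt_const.mul ((normAtPlace_contDiffAt K w x (hx w)).log (hx w))
  · push Not at hx
    obtain ⟨w, hw⟩ := hx
    obtain ⟨a, R, ha, -, hs⟩ := gfun_support K
    have hev : gfun K =ᶠ[nhds x] fun _ => 0 := by
      have : ∀ᶠ y in nhds x, normAtPlace w y < a :=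
        (continuous_normAtPlace w).continuousAt.eventually_lt_const (by rw [hw]; exact ha)
      filter_upwards [this] with y hy
      by_contra hne
      exact absurd (hs y hne w).1 (not_le.2 hy)
    exact contDiffAt_const.congr_of_eventuallyEq hev

open scoped Classical in
/-- The weight pulled back to coordinates is Lipschitz with bounded support. -/
lemma gfun_lipschitz {ι : Type*} [Fintype ι] (b : Module.Basis ι ℝ (mixedSpace K)) :
    ∃ L R : ℝ, 0 ≤ L ∧ 0 ≤ R ∧ (∀ x y : ι → ℝ, |gfun K (b.equivFun.symm x) -
      gfun K (b.equivFun.symm y)| ≤ L * ‖x - y‖) ∧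
      ∀ x : ι → ℝ, gfun K (b.equivFun.symm x) ≠ 0 → ‖x‖ ≤ R := by
  obtain ⟨a, R, ha, hR, hs⟩ := gfun_support K
  set T := b.equivFunL
  set f : (ι → ℝ) → ℝ := fun x => gfun K (T.symm x) with hf
  have hcd : ContDiff ℝ 1 f := (gfun_contDiff K).comp T.symm.contDiff
  have hb : ∀ x, f x ≠ 0 → ‖x‖ ≤ ‖(T : mixedSpace K →L[ℝ] (ι → ℝ))‖ * R := by
    intro x hx
    have h1 : ‖T.symm x‖ ≤ R := by
      rw [norm_eq_sup'_normAtPlace]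
      exact Finset.sup'_le _ _ (fun w _ => (hs _ hx w).2)
    have := (T : mixedSpace K →L[ℝ] (ι → ℝ)).le_opNorm_of_le h1
    simpa using this
  have hc : HasCompactSupport f := by
    refine HasCompactSupport.of_support_subset_isCompact
      (isCompact_closedBall 0 (‖(T : mixedSpace K →L[ℝ] (ι → ℝ))‖ * R)) ?_
    intro x hx
    rw [mem_closedBall_zero_iff]
    exact hb x hx
  obtain ⟨C, hC⟩ := hcd.lipschitzWith_of_hasCompactSupport hc one_ne_zero
  refine ⟨C, ‖(T : mixedSpace K →L[ℝ] (ι → ℝ))‖ * R, C.2, by positivity, ?_, hb⟩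
  intro x y
  have := hC.dist_le_mul x y
  rw [Real.dist_eq, dist_eq_norm] at this
  exact this

lemma lcoord_smul {c : ℝ} (hc : 0 < c) {x : mixedSpace K} (hx : ∀ w, normAtPlace w x ≠ 0)
    (i : InfinitePlace K) :
    lcoord K (c • x) i = lcoord K x i +
      Real.log c * (Finsupp.single dirichletUnitTheorem.w₀ (1 : ℝ)) i := by
  have h : (fun w => (mult w : ℝ) * Real.log (normAtPlace w (c • x))) =
      (fun w => (mult w : ℝ) * Real.log (normAtPlace w x)) +
        Real.log c • fundamentalCone.completeBasis K dirichletUnitTheorem.w₀ := by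
    funext w
    rw [normAtPlace_smul, abs_of_pos hc, Real.log_mul hc.ne' (hx w),
      fundamentalCone.completeBasis_apply_of_eq]
    simp only [Pi.add_apply, Pi.smul_apply, smul_eq_mul]
    ring
  unfold lcoord
  rw [h, map_add, map_smul]
  simp

lemma lcoord_sum (a : K) (ha : a ≠ 0) :
    lcoord K (mixedEmbedding K a) dirichletUnitTheorem.w₀ =
      Real.log |((Algebra.norm ℚ a : ℚ) : ℝ)| / Module.finrank ℚ K := by
  classical
  set ξ := lcoord K (mixedEmbedding K a) with hξ
  have h1 := (fundamentalCone.completeBasis K).sum_equivFun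
    (fun w => (mult w : ℝ) * Real.log (normAtPlace w (mixedEmbedding K a)))
  have h2 := congrArg (fun v : realSpace K => ∑ w, v w) h1
  simp only [Finset.sum_apply, Pi.smul_apply, smul_eq_mul] at h2
  rw [Finset.sum_comm] at h2
  simp_rw [← Finset.mul_sum] at h2
  have h3 : ∑ w, (mult w : ℝ) * Real.log (normAtPlace w (mixedEmbedding K a)) =
      Real.log |((Algebra.norm ℚ a : ℚ) : ℝ)| := by
    have := fundamentalCone.sum_expMap_symm_apply ha
    simpa [fundamentalCone.expMap_symm_apply] using this
  rw [h3, Fintype.sum_eq_add_sum_subtype_ne _ dirichletUnitTheorem.w₀,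
    Finset.sum_eq_zero (s := (Finset.univ : Finset {w : InfinitePlace K //
      w ≠ dirichletUnitTheorem.w₀})), add_zero, fundamentalCone.completeBasis_apply_of_eq, ← Nat.cast_sum,
    sum_mult_eq] at h2
  · rw [eq_div_iff (Nat.cast_ne_zero.mpr Module.finrank_pos.ne'), ← h2]
    rfl
  · intro i _
    rw [fundamentalCone.completeBasis_apply_of_ne,
      fundamentalCone.sum_expMap_symm_apply (coe_ne_zero _), Units.norm]
    simp

open Classical in
lemma lcoord_unit (ζ : torsion K) (e : Fin (rank K) → ℤ) (a : K) (ha : a ≠ 0)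
    (i : InfinitePlace K) :
    lcoord K (mixedEmbedding K
      ((((ζ : (𝓞 K)ˣ) * ∏ j, fundSystem K j ^ e j : (𝓞 K)ˣ) : K) * a)) i =
      lcoord K (mixedEmbedding K a) i +
        if h : i = dirichletUnitTheorem.w₀ then 0
        else (e (fundamentalCone.equivFinRank.symm ⟨i, h⟩) : ℝ) := by
  have h : (fun w : InfinitePlace K => (mult w : ℝ) * Real.log (normAtPlace w (mixedEmbedding K
      ((((ζ : (𝓞 K)ˣ) * ∏ j, fundSystem K j ^ e j : (𝓞 K)ˣ) : K) * a)))) =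
      (fun w => (mult w : ℝ) * Real.log (normAtPlace w (mixedEmbedding K a))) +
        ∑ j : {w : InfinitePlace K // w ≠ dirichletUnitTheorem.w₀},
          (e (fundamentalCone.equivFinRank.symm j) : ℝ) • fundamentalCone.completeBasis K j := by
    funext w
    have hζ : w ((ζ : (𝓞 K)ˣ) : K) = 1 := (mem_torsion K).1 ζ.2 w
    have hw : w ((((ζ : (𝓞 K)ˣ) * ∏ j, fundSystem K j ^ e j : (𝓞 K)ˣ) : K) * a) =
        (∏ j, w (fundSystem K j : K) ^ e j) * w a := by
      simp [hζ, Units.coe_zpow]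
    rw [normAtPlace_apply, hw, Real.log_mul, Real.log_prod]
    · simp only [Pi.add_apply, Finset.sum_apply, Pi.smul_apply, smul_eq_mul, normAtPlace_apply]
      rw [mul_add, add_comm, Finset.mul_sum]
      congr 1
      rw [← fundamentalCone.equivFinRank.sum_comp]
      refine Finset.sum_congr rfl (fun j _ => ?_)
      rw [fundamentalCone.completeBasis_apply_of_ne, fundamentalCone.expMap_symm_apply,
        normAtAllPlaces_mixedEmbedding, Real.log_zpow, Equiv.symm_apply_apply]
      ring
    · intro j _
      exact zpow_ne_zero _ ((map_ne_zero w).2 (coe_ne_zero _))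
    · exact Finset.prod_ne_zero_iff.2 (fun j _ => zpow_ne_zero _ ((map_ne_zero w).2 (coe_ne_zero _)))
    · exact (map_ne_zero w).2 ha
  unfold lcoord
  rw [h, map_add, map_sum, Pi.add_apply, Finset.sum_apply]
  congr 1
  simp only [map_smul, Pi.smul_apply, smul_eq_mul, Module.Basis.equivFun_apply,
    Module.Basis.repr_self]
  split_ifs with h0
  · refine Finset.sum_eq_zero (fun j _ => ?_)
    rw [Finsupp.single_eq_of_ne (by rw [h0]; exact j.2.symm), mul_zero]
  · rw [Finset.sum_eq_single ⟨i, h0⟩]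
    · simp
    · intro j _ hj
      rw [Finsupp.single_eq_of_ne (fun h => hj (Subtype.ext h.symm)), mul_zero]
    · simp

/-- Units as torsion times a free part. -/
def unitEquiv : torsion K × (Fin (rank K) → ℤ) ≃ (𝓞 K)ˣ :=
  Equiv.ofBijective (fun p => p.1 * ∏ i, (fundSystem K i) ^ (p.2 i)) <| by
    rw [Function.bijective_iff_existsUnique]
    intro u
    obtain ⟨p, hp, hu⟩ := exist_unique_eq_mul_prod K u
    exact ⟨p, hp.symm, fun q hq => hu q hq.symm⟩

lemma gfun_unit (a : K) (ha : a ≠ 0) (k : ℕ) (p : torsion K × (Fin (rank K) → ℤ)) :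
    gfun K (((2 : ℝ) ^ k)⁻¹ • mixedEmbedding K ((unitEquiv K p : K) * a)) =
      ((2 ^ Module.finrank ℚ K) ^ k * (|((Algebra.norm ℚ a : ℚ) : ℝ)|⁻¹ *
        bump (Real.log |((Algebra.norm ℚ a : ℚ) : ℝ)| /
          (Module.finrank ℚ K * Real.log 2) - k))) *
      ∏ j, bump (lcoord K (mixedEmbedding K a) (fundamentalCone.equivFinRank j) + p.2 j) := by
  classical
  obtain ⟨ζ, e⟩ := p
  generalize hu : unitEquiv K (ζ, e) = u
  have hue : u = (ζ : (𝓞 K)ˣ) * ∏ j, fundSystem K j ^ e j := hu.symm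
  generalize hN : |((Algebra.norm ℚ a : ℚ) : ℝ)| = N
  have hNpos : 0 < N := by
    rw [← hN, abs_pos]
    exact_mod_cast (Algebra.norm_ne_zero_iff.2 ha)
  have hn : (Module.finrank ℚ K : ℝ) ≠ 0 := Nat.cast_ne_zero.mpr Module.finrank_pos.ne'
  have hl : Real.log 2 ≠ 0 := (Real.log_pos (by norm_num)).ne'
  have hne : ∀ w, normAtPlace w (mixedEmbedding K ((u : K) * a)) ≠ 0 := by
    intro w
    rw [normAtPlace_apply]
    exact (map_ne_zero w).2 (mul_ne_zero (coe_ne_zero _) ha)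
  have hne2 : ∀ w, normAtPlace w (((2 : ℝ) ^ k)⁻¹ •
      mixedEmbedding K ((u : K) * a)) ≠ 0 := by
    intro w
    rw [normAtPlace_smul]
    exact mul_ne_zero (by positivity) (hne w)
  have hco0 : lcoord K (((2 : ℝ) ^ k)⁻¹ •
      mixedEmbedding K ((u : K) * a)) dirichletUnitTheorem.w₀ =
      Real.log N / Module.finrank ℚ K + -((k : ℝ) * Real.log 2) := by
    rw [lcoord_smul K (by positivity) hne, hue, lcoord_unit K ζ e a ha, lcoord_sum K a ha]
    simp [← hN]
  have hcoi : ∀ j, lcoord K (((2 : ℝ) ^ k)⁻¹ •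
      mixedEmbedding K ((u : K) * a)) (fundamentalCone.equivFinRank j) =
      lcoord K (mixedEmbedding K a) (fundamentalCone.equivFinRank j) + e j := by
    intro j
    rw [lcoord_smul K (by positivity) hne, hue, lcoord_unit K ζ e a ha,
      dif_neg (fundamentalCone.equivFinRank j).2, Finsupp.single_eq_of_ne
      (fundamentalCone.equivFinRank j).2]
    simp
  rw [gfun, if_pos hne2, wtF, hco0, ← fundamentalCone.equivFinRank.prod_comp]
  simp_rw [hcoi]
  congr 1
  rw [show (Real.log N / Module.finrank ℚ K + -((k : ℝ) * Real.log 2)) / Real.log 2 =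
    Real.log N / (Module.finrank ℚ K * Real.log 2) - k by field_simp; ring, ← mul_assoc]
  congr 1
  rw [show -((Module.finrank ℚ K : ℝ) * (Real.log N / Module.finrank ℚ K +
      -((k : ℝ) * Real.log 2))) = (Module.finrank ℚ K * k : ℕ) * Real.log 2 - Real.log N by
    push_cast; field_simp; ring]
  rw [Real.exp_sub, Real.exp_log hNpos, ← Real.log_pow, Real.exp_log (by positivity), pow_mul,
    div_eq_mul_inv]

lemma hasSum_torsion : HasSum (fun _ : torsion K => (1 : ℝ)) (torsionOrder K) := by
  have : Fintype (torsion K) := Fintype.ofFinite _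
  convert hasSum_fintype (fun _ : torsion K => (1 : ℝ)) using 1
  rw [Finset.sum_const, Finset.card_univ, nsmul_eq_mul, mul_one, torsionOrder,
    Nat.card_eq_fintype_card]

lemma hasSum_of_equiv {U T E : Type*} (e : T × E ≃ U) (f : U → ℝ) (B w : ℝ) (g : E → ℝ)
    (hT : HasSum (fun _ : T => (1 : ℝ)) w) (hg : HasSum g 1)
    (h : ∀ p, f (e p) = B * g p.2) : HasSum f (w * B) := by
  have h1 := hg.mul_left B
  rw [mul_one] at h1
  have h3 := hT.mul h1 (summable_mul_of_summable_norm hT.summable.norm h1.summable.norm)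
  rw [← e.hasSum_iff]
  refine h3.congr_fun ?_
  intro p
  rw [one_mul]
  exact h p

lemma unit_sum (a : K) (ha : a ≠ 0) (k : ℕ) :
    HasSum (fun u : (𝓞 K)ˣ => gfun K (((2 : ℝ) ^ k)⁻¹ • mixedEmbedding K ((u : K) * a)))
      (torsionOrder K * ((2 ^ Module.finrank ℚ K) ^ k * (|((Algebra.norm ℚ a : ℚ) : ℝ)|⁻¹ *
        bump (Real.log |((Algebra.norm ℚ a : ℚ) : ℝ)| /
          (Module.finrank ℚ K * Real.log 2) - k)))) := by
  exact hasSum_of_equiv (unitEquiv K) _ _ _ _ (hasSum_torsion K)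
    (hasSum_bump_pi (fun j => lcoord K (mixedEmbedding K a)
      (fundamentalCone.equivFinRank (K := K) j))) (gfun_unit K a ha k)

open nonZeroDivisors in
lemma exists_ideal_basis (J : Ideal (𝓞 K)) (hJ : J ≠ ⊥) :
    ∃ (ι : Type) (_ : Fintype ι) (b : Module.Basis ι ℝ (mixedSpace K)) (e : (ι → ℤ) ≃ J),
      Fintype.card ι = Module.finrank ℚ K ∧
      ∀ m, b.equivFun.symm (fun i => (m i : ℝ)) = mixedEmbedding K (((e m : 𝓞 K)) : K) := by
  have hJ' : J ∈ (Ideal (𝓞 K))⁰ := mem_nonZeroDivisors_of_ne_zero hJ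
  set I : (FractionalIdeal (𝓞 K)⁰ K)ˣ := FractionalIdeal.mk0 K ⟨J, hJ'⟩ with hI
  set b := fractionalIdealLatticeBasis K I
  set fb := fractionalIdealBasis K I.1
  have hIJ : ∀ x : K, x ∈ I.1 ↔ ∃ y ∈ J, algebraMap (𝓞 K) K y = x := by
    intro x
    rw [hI, FractionalIdeal.coe_mk0]
    exact FractionalIdeal.mem_coeIdeal _
  let E : J ≃ I.1 := Equiv.ofBijective
    (fun y => ⟨algebraMap (𝓞 K) K y, (hIJ _).2 ⟨y, y.2, rfl⟩⟩) (by
      constructor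
      · intro x y h
        exact Subtype.ext (RingOfIntegers.coe_injective (congrArg (fun z : I.1 => (z : K)) h))
      · rintro ⟨x, hx⟩
        obtain ⟨y, hy, rfl⟩ := (hIJ x).1 hx
        exact ⟨⟨y, hy⟩, rfl⟩)
  let e0 : (Fin (Fintype.card (Module.Free.ChooseBasisIndex ℤ I.1))) ≃
    Module.Free.ChooseBasisIndex ℤ I.1 := (Fintype.equivFin _).symm
  refine ⟨Fin (Fintype.card (Module.Free.ChooseBasisIndex ℤ I.1)), inferInstance,
    b.reindex e0.symm, ((fb.reindex e0.symm).equivFun.symm.toEquiv.trans E.symm), ?_, ?_⟩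
  · rw [Fintype.card_fin, ← Module.finrank_eq_card_basis b, mixedEmbedding.finrank]
  · intro m
    have h : ∀ z : I.1, ((E.symm z : 𝓞 K) : K) = z := by
      intro z
      exact congrArg Subtype.val (E.apply_symm_apply z)
    rw [Equiv.trans_apply, h]
    rw [LinearEquiv.coe_toEquiv, Module.Basis.equivFun_symm_apply, Module.Basis.equivFun_symm_apply]
    rw [AddSubmonoidClass.coe_finsetSum, map_sum]
    refine Finset.sum_congr rfl (fun i _ => ?_)
    rw [Module.Basis.reindex_apply, Module.Basis.reindex_apply, fractionalIdealLatticeBasis_apply,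
      basisOfFractionalIdeal_apply]
    rw [Equiv.symm_symm, Int.cast_smul_eq_zsmul, ← map_zsmul]
    rfl

variable {K} in
/-- nonzero principal ideals inside J -/
abbrev QJ (J : Ideal (𝓞 K)) := {I : Ideal (𝓞 K) // I ≠ ⊥ ∧ I.IsPrincipal ∧ I ≤ J}

/-- a generator -/
def gen {J : Ideal (𝓞 K)} (I : QJ J) : 𝓞 K := I.2.2.1.principal.choose

lemma gen_span {J : Ideal (𝓞 K)} (I : QJ J) : I.1 = Ideal.span {gen K I} :=
  I.2.2.1.principal.choose_spec

lemma gen_ne {J : Ideal (𝓞 K)} (I : QJ J) : gen K I ≠ 0 := by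
  intro h
  apply I.2.1
  rw [gen_span K I, h]
  simp

lemma gen_norm {J : Ideal (𝓞 K)} (I : QJ J) :
    |((Algebra.norm ℚ (gen K I : K) : ℚ) : ℝ)| = absNorm I.1 := by
  conv_rhs => rw [gen_span K I, absNorm_span_singleton]
  rw [← Algebra.coe_norm_int, Nat.cast_natAbs]
  simp

lemma gen_mem {J : Ideal (𝓞 K)} (p : QJ J × (𝓞 K)ˣ) : (p.2 : 𝓞 K) * gen K p.1 ∈ J := by
  apply Ideal.mul_mem_left
  apply p.1.2.2.2
  rw [gen_span K p.1]
  exact Ideal.mem_span_singleton_self _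

lemma principal_sum (J : Ideal (𝓞 K)) (k : ℕ) (S : ℝ)
    (h : HasSum (fun a : J => gfun K (((2 : ℝ) ^ k)⁻¹ • mixedEmbedding K ((a : 𝓞 K) : K))) S) :
    HasSum (fun I : QJ J => (torsionOrder K * ((2 ^ Module.finrank ℚ K) ^ k *
      ((absNorm I.1 : ℝ)⁻¹ * bump (Real.log (absNorm I.1) /
          (Module.finrank ℚ K * Real.log 2) - k))))) S := by
  have hinj : Function.Injective (fun p : QJ J × (𝓞 K)ˣ => (⟨_, gen_mem K p⟩ : J)) := by
    rintro ⟨I, u⟩ ⟨I', u'⟩ h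
    have h1 : (u : 𝓞 K) * gen K I = u' * gen K I' := congrArg Subtype.val h
    have h2 : I = I' := by
      apply Subtype.ext
      rw [gen_span K I, gen_span K I', Ideal.span_singleton_eq_span_singleton]
      exact ⟨u * u'⁻¹, by
        rw [Units.val_mul, ← mul_assoc, mul_comm (gen K I), h1, mul_comm (u' : 𝓞 K), mul_assoc,
          Units.mul_inv, mul_one]⟩
    subst h2
    rw [Prod.mk.injEq]
    exact ⟨rfl, Units.ext (mul_right_cancel₀ (gen_ne K I) h1)⟩
  rw [← hinj.hasSum_iff] at h
  · refine h.prod_fiberwise (fun I => ?_)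
    have := unit_sum K (gen K I : K) (by simpa using gen_ne K I) k
    rw [gen_norm] at this
    refine this.congr_fun (fun u => ?_)
    simp
  · intro x hx
    by_cases hx0 : (x : 𝓞 K) = 0
    · unfold gfun
      rw [if_neg]
      rw [hx0]
      simp
    · exfalso
      apply hx
      have hI : Ideal.span {(x : 𝓞 K)} ≠ ⊥ ∧ (Ideal.span {(x : 𝓞 K)}).IsPrincipal ∧
        Ideal.span {(x : 𝓞 K)} ≤ J := ⟨by simpa using hx0, ⟨⟨_, rfl⟩⟩, by
          rw [Ideal.span_singleton_le_iff_mem]; exact x.2⟩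
      have h1 := gen_span K (⟨_, hI⟩ : QJ J)
      rw [Ideal.span_singleton_eq_span_singleton] at h1
      obtain ⟨u, hu⟩ := h1.symm
      refine ⟨(⟨_, hI⟩, u), Subtype.ext ?_⟩
      exact (mul_comm _ _).trans hu

lemma bump_asymp (J : Ideal (𝓞 K)) (hJ : J ≠ ⊥) : ∃ κ C : ℝ, ∀ k : ℕ, ∃ S : ℝ,
    HasSum (fun I : QJ J => (absNorm I.1 : ℝ)⁻¹ * bump (Real.log (absNorm I.1) /
          (Module.finrank ℚ K * Real.log 2) - k)) S ∧ |S - κ| ≤ C * (1 / 2) ^ k := by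
  obtain ⟨ι, hι, b, e, hcard, hb⟩ := exists_ideal_basis K J hJ
  obtain ⟨L, R, hL0, hR0, hL, hR⟩ := gfun_lipschitz K b
  obtain ⟨κ, C, h⟩ := lattice_sum hL0 hR0 hL hR
  obtain ⟨w, hw⟩ : ∃ w : ℝ, w = (torsionOrder K : ℝ) := ⟨_, rfl⟩
  have hwpos : 0 < w := by
    rw [hw]
    exact Nat.cast_pos.2 (torsionOrder_pos K)
  refine ⟨w⁻¹ * κ, w⁻¹ * C, fun k => ?_⟩
  have hs := (summable_lattice hR0 hR k).hasSum
  set S0 := ∑' m : ι → ℤ, gfun K (b.equivFun.symm (fun i => (m i : ℝ) / 2 ^ k)) with hS0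
  have hc : ∀ m : ι → ℤ, b.equivFun.symm (fun i => (m i : ℝ) / 2 ^ k) =
      ((2 : ℝ) ^ k)⁻¹ • mixedEmbedding K ((e m : 𝓞 K) : K) := by
    intro m
    rw [← hb, ← map_smul]
    congr 1
    funext i
    simp [div_eq_inv_mul]
  have h1 : HasSum (fun a : J => gfun K (((2 : ℝ) ^ k)⁻¹ • mixedEmbedding K ((a : 𝓞 K) : K))) S0 := by
    rw [← e.hasSum_iff]
    refine hs.congr_fun (fun m => ?_)
    rw [hc]
    rfl
  have h2 := principal_sum K J k S0 h1
  rw [← hw] at h2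
  replace h2 := h2.mul_left (w⁻¹ * ((2 ^ Module.finrank ℚ K) ^ k)⁻¹)
  refine ⟨_, h2.congr_fun (fun I => ?_), ?_⟩
  · field_simp
  · have h3 := h k
    rw [hcard] at h3
    rw [mul_assoc, ← mul_sub, abs_mul, abs_of_pos (inv_pos.2 hwpos), mul_assoc]
    exact mul_le_mul_of_nonneg_left h3 (inv_pos.2 hwpos).le

open scoped Classical in
lemma dyadic {Q : Type*} (N : Q → ℝ) (hN : ∀ q, 1 ≤ N q) (hfin : ∀ X : ℝ, {q | N q ≤ X}.Finite)
    (d : ℝ) (hd : 0 < d) (κ C : ℝ)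
    (h : ∀ k : ℕ, ∃ S : ℝ, HasSum (fun q => (N q)⁻¹ * bump (Real.log (N q) / d - k)) S ∧
      |S - κ| ≤ C * (1 / 2) ^ k) :
    ∃ κ' C' : ℝ, ∀ X : ℝ, 1 ≤ X → ∃ T : ℝ,
      HasSum (fun q => if N q ≤ X then (N q)⁻¹ else 0) T ∧ |T - κ' * Real.log X| ≤ C' := by
  choose S hS hSκ using h
  have hC : 0 ≤ C := by simpa using (abs_nonneg _).trans (hSκ 0)
  have hD : ∀ m : ℕ, HasSum (fun q => (N q)⁻¹ *
      (1 - Real.smoothTransition (Real.log (N q) / d - m + 1))) (∑ k ∈ Finset.range m, S k) := by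
    intro m
    refine (hasSum_sum (s := Finset.range m) (fun k _ => hS k)).congr_fun (fun q => ?_)
    rw [← Finset.mul_sum, bump_sum_range _ (div_nonneg (Real.log_nonneg (hN q)) hd.le)]
  have hDκ : ∀ m : ℕ, |(∑ k ∈ Finset.range m, S k) - κ * m| ≤ 2 * C := by
    intro m
    have h1 : (∑ k ∈ Finset.range m, S k) - κ * m = ∑ k ∈ Finset.range m, (S k - κ) := by
      simp [mul_comm]
    rw [h1]
    refine (Finset.abs_sum_le_sum_abs _ _).trans
      ((Finset.sum_le_sum (fun k _ => hSκ k)).trans ?_)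
    rw [← Finset.mul_sum, mul_comm 2]
    refine mul_le_mul_of_nonneg_left ?_ hC
    have := (summable_geometric_two).sum_le_tsum (Finset.range m) (fun i _ => by positivity)
    rwa [tsum_geometric_two] at this
  refine ⟨κ / d, 2 * C + 2 * |κ|, fun X hX => ?_⟩
  have hsum : Summable (fun q => if N q ≤ X then (N q)⁻¹ else 0) := by
    refine summable_of_ne_finset_zero (s := (hfin X).toFinset) (fun q hq => if_neg ?_)
    simpa using hq
  refine ⟨_, hsum.hasSum, ?_⟩
  set T := ∑' q, (if N q ≤ X then (N q)⁻¹ else 0)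
  set y := Real.log X / d with hy
  have hy0 : 0 ≤ y := div_nonneg (Real.log_nonneg hX) hd.le
  set m := ⌊y⌋₊ with hm
  have hm1 : (m : ℝ) ≤ y := Nat.floor_le hy0
  have hm2 : y < m + 1 := Nat.lt_floor_add_one y
  have hpos : ∀ q, 0 < N q := fun q => lt_of_lt_of_le one_pos (hN q)
  have hlo : ∑ k ∈ Finset.range m, S k ≤ T := by
    refine hasSum_le (fun q => ?_) (hD m) hsum.hasSum
    split_ifs with hq
    · have := Real.smoothTransition.nonneg (Real.log (N q) / d - m + 1)
      exact mul_le_of_le_one_right (inv_pos.2 (hpos q)).le (by linarith)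
    · push Not at hq
      have : y ≤ Real.log (N q) / d := by
        rw [hy]
        gcongr
      rw [Real.smoothTransition.one_of_one_le (by linarith)]
      simp
  have hhi : T ≤ ∑ k ∈ Finset.range (m + 2), S k := by
    refine hasSum_le (fun q => ?_) hsum.hasSum (hD (m + 2))
    split_ifs with hq
    · have : Real.log (N q) / d ≤ y := by
        rw [hy]
        have := hpos q
        gcongr
      rw [Real.smoothTransition.zero_of_nonpos (by push_cast; linarith)]
      simp
    · have := Real.smoothTransition.le_one (Real.log (N q) / d - (m + 2 : ℕ) + 1)
      exact mul_nonneg (inv_pos.2 (hpos q)).le (by linarith)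
  have hA := abs_le.1 (hDκ m)
  have hB := abs_le.1 (hDκ (m + 2))
  push_cast at hB
  have e1 : |κ * (y - m)| ≤ 2 * |κ| := by
    rw [abs_mul, mul_comm]
    refine mul_le_mul_of_nonneg_right ?_ (abs_nonneg _)
    rw [abs_le]; constructor <;> linarith
  have e2 : |κ * (m + 2 - y)| ≤ 2 * |κ| := by
    rw [abs_mul, mul_comm]
    refine mul_le_mul_of_nonneg_right ?_ (abs_nonneg _)
    rw [abs_le]; constructor <;> linarith
  rw [abs_le] at e1 e2
  rw [div_mul_eq_mul_div, mul_div_assoc, ← hy, abs_le]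
  constructor <;> nlinarith

lemma one_le_norm {I : Ideal (𝓞 K)} (hI : I ≠ ⊥) : (1 : ℝ) ≤ absNorm I := by
  exact_mod_cast Nat.one_le_iff_ne_zero.2 (fun h => hI (absNorm_eq_zero_iff.1 h))

lemma finite_norm (X : ℝ) : {I : Ideal (𝓞 K) | (absNorm I : ℝ) ≤ X}.Finite := by
  refine (Ideal.finite_setOfPred_absNorm_le (S := 𝓞 K) ⌊X⌋₊).subset (fun I hI => ?_)
  exact Nat.le_floor hI

open scoped Classical in
lemma principal_asymp (J : Ideal (𝓞 K)) (hJ : J ≠ ⊥) :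
    ∃ κ' C' : ℝ, ∀ X : ℝ, 1 ≤ X → ∃ T : ℝ,
      HasSum (fun q : QJ J => if (absNorm q.1 : ℝ) ≤ X then (absNorm q.1 : ℝ)⁻¹ else 0) T ∧
        |T - κ' * Real.log X| ≤ C' := by
  obtain ⟨κ, C, h⟩ := bump_asymp K J hJ
  refine dyadic (fun q : QJ J => (absNorm q.1 : ℝ)) (fun q => one_le_norm K q.2.1) (fun X => ?_)
    (Module.finrank ℚ K * Real.log 2) ?_ κ C h
  · exact (finite_norm K X).preimage Subtype.val_injective.injOn
  · exact mul_pos (Nat.cast_pos.2 Module.finrank_pos) (Real.log_pos (by norm_num))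

open scoped Classical nonZeroDivisors in
lemma class_asymp (c : ClassGroup (𝓞 K)) :
    ∃ κ' C' : ℝ, ∀ X : ℝ, 1 ≤ X → ∃ T : ℝ,
      HasSum (fun q : {I : (Ideal (𝓞 K))⁰ // ClassGroup.mk0 I = c} =>
        if (absNorm q.1.1 : ℝ) ≤ X then (absNorm q.1.1 : ℝ)⁻¹ else 0) T ∧
        |T - κ' * Real.log X| ≤ C' := by
  obtain ⟨J, hJ⟩ := ClassGroup.mk0_surjective (R := 𝓞 K) c⁻¹
  have hJ0 : J.1 ≠ ⊥ := nonZeroDivisors.coe_ne_zero J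
  obtain ⟨κ, C, h⟩ := principal_asymp K J.1 hJ0
  let e : {I : (Ideal (𝓞 K))⁰ // ClassGroup.mk0 I = c} ≃ QJ J.1 := Equiv.ofBijective
    (fun I => ⟨(I.1 * J : (Ideal (𝓞 K))⁰), nonZeroDivisors.coe_ne_zero _, by
      rw [← ClassGroup.mk0_eq_one_iff (SetLike.coe_mem _), map_mul, I.2, hJ, mul_inv_cancel],
      show I.1.1 * J.1 ≤ J.1 from Ideal.mul_le_right⟩) (by
    constructor
    · intro I I' h
      have h1 : I.1.1 * J.1 = I'.1.1 * J.1 := congrArg Subtype.val h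
      exact Subtype.ext (Subtype.ext (mul_right_cancel₀ hJ0 h1))
    · rintro ⟨I, hI0, hIp, hIJ⟩
      obtain ⟨A, hA⟩ := Ideal.dvd_iff_le.2 hIJ
      have hA0 : A ≠ ⊥ := by
        rintro rfl
        apply hI0
        rw [hA]
        simp
      have hAm : A ∈ (Ideal (𝓞 K))⁰ := mem_nonZeroDivisors_of_ne_zero hA0
      refine ⟨⟨⟨A, hAm⟩, ?_⟩, Subtype.ext ?_⟩
      · have h1 : ClassGroup.mk0 (⟨A, hAm⟩ * J) = 1 := by
          rw [ClassGroup.mk0_eq_one_iff (SetLike.coe_mem _)]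
          have : ((⟨A, hAm⟩ * J : (Ideal (𝓞 K))⁰) : Ideal (𝓞 K)) = I := by
            rw [hA, mul_comm]; rfl
          rw [this]
          exact hIp
        rw [map_mul, hJ] at h1
        exact mul_inv_eq_one.1 h1
      · exact (mul_comm _ _).trans hA.symm)
  have he : ∀ I, (absNorm (e I).1 : ℝ) = absNorm I.1.1 * absNorm J.1 := by
    intro I
    have : (e I).1 = I.1.1 * J.1 := rfl
    rw [this, map_mul, Nat.cast_mul]
  have hn := one_le_norm K hJ0
  generalize (absNorm J.1 : ℝ) = n at he hn
  have hn0 : 0 < n := by linarith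
  refine ⟨n * κ, n * (C + |κ * Real.log n|), fun X hX => ?_⟩
  obtain ⟨T, hT, hTκ⟩ := h (X * n) (by nlinarith)
  refine ⟨n * T, ?_, ?_⟩
  · rw [← e.hasSum_iff] at hT
    refine (hT.mul_left n).congr_fun (fun I => ?_)
    simp only [Function.comp_apply]
    rw [he]
    have hiff : ((absNorm I.1.1 : ℝ) * n ≤ X * n) ↔ (absNorm I.1.1 : ℝ) ≤ X :=
      mul_le_mul_iff_left₀ hn0
    by_cases hle : (absNorm I.1.1 : ℝ) ≤ X
    · rw [if_pos hle, if_pos (hiff.2 hle)]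
      field_simp
    · rw [if_neg hle, if_neg (fun h => hle (hiff.1 h)), mul_zero]
  · rw [mul_assoc, ← mul_sub, abs_mul, abs_of_pos hn0]
    refine mul_le_mul_of_nonneg_left ?_ hn0.le
    rw [Real.log_mul (by linarith) hn0.ne'] at hTκ
    have := abs_add_le (T - κ * (Real.log X + Real.log n)) (κ * Real.log n)
    rw [show T - κ * (Real.log X + Real.log n) + κ * Real.log n = T - κ * Real.log X by ring] at this
    linarith

open scoped Classical in
lemma ideal_asymp : ∃ κ C : ℝ, ∀ X : ℝ, 1 ≤ X →
    |(∑' a : {a : Ideal (𝓞 K) // a ≠ ⊥ ∧ (absNorm a : ℝ) ≤ X},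
          ((absNorm a.1 : ℝ))⁻¹) - κ * Real.log X| ≤ C := by
  choose κ C h using class_asymp K
  refine ⟨∑ c, κ c, ∑ c, C c, fun X hX => ?_⟩
  have h' := fun c => h c X hX
  choose T hT hTκ using h'
  have h1 : HasSum (fun p : Σ c : ClassGroup (𝓞 K), {I : (nonZeroDivisors (Ideal (𝓞 K))) //
      ClassGroup.mk0 I = c} => if (absNorm p.2.1.1 : ℝ) ≤ X then (absNorm p.2.1.1 : ℝ)⁻¹ else 0)
      (∑ c, T c) := by
    refine HasSum.sigma_of_hasSum (hasSum_fintype T) hT ?_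
    refine summable_of_hasFiniteSupport (((finite_norm K X).preimage (f := fun p : Σ c :
      ClassGroup (𝓞 K), {I : (nonZeroDivisors (Ideal (𝓞 K))) // ClassGroup.mk0 I = c} =>
      p.2.1.1) ?_).subset ?_)
    · rintro ⟨c, I, rfl⟩ _ ⟨c', I', rfl⟩ _ h
      have : I = I' := Subtype.ext h
      subst this
      rfl
    · intro p hp
      by_contra hq
      exact hp (if_neg hq)
  have h2 : HasSum (fun a : {a : Ideal (𝓞 K) // a ≠ ⊥ ∧ (absNorm a : ℝ) ≤ X} =>
      ((absNorm a.1 : ℝ))⁻¹) (∑ c, T c) := by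
    have hi : Function.Injective (fun a : {a : Ideal (𝓞 K) // a ≠ ⊥ ∧ (absNorm a : ℝ) ≤ X} =>
      (⟨ClassGroup.mk0 ⟨a.1, mem_nonZeroDivisors_of_ne_zero a.2.1⟩,
        ⟨⟨a.1, mem_nonZeroDivisors_of_ne_zero a.2.1⟩, rfl⟩⟩ : Σ c : ClassGroup (𝓞 K),
        {I : (nonZeroDivisors (Ideal (𝓞 K))) // ClassGroup.mk0 I = c})) := by
      intro a b hab
      have := congrArg (fun p : Σ c : ClassGroup (𝓞 K),
        {I : (nonZeroDivisors (Ideal (𝓞 K))) // ClassGroup.mk0 I = c} => p.2.1.1) hab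
      exact Subtype.ext this
    rw [← hi.hasSum_iff] at h1
    · refine h1.congr_fun (fun a => ?_)
      simp only [Function.comp_apply]
      rw [if_pos a.2.2]
    · rintro ⟨c, I, rfl⟩ hp
      refine if_neg (fun hle => hp ⟨⟨I.1, nonZeroDivisors.coe_ne_zero I, hle⟩, rfl⟩)
  rw [h2.tsum_eq, Finset.sum_mul, ← Finset.sum_sub_distrib]
  exact (Finset.abs_sum_le_sum_abs _ _).trans (Finset.sum_le_sum (fun c _ => hTκ c))

open Asymptotics in
lemma const_unique (A T : ℕ → ℝ) (κ c C : ℝ)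
    (hstep : ∀ n, T (n + 1) = T n + (A (n + 1) - A n) / (n + 1))
    (hA : Tendsto (fun n : ℕ => A n / n) atTop (nhds c))
    (hT : ∀ n : ℕ, 1 ≤ n → |T n - κ * Real.log n| ≤ C) : κ = c := by
  have habel : ∀ n : ℕ, T (n + 1) = A (n + 1) / (n + 1) + (T 1 - A 1) +
      ∑ i ∈ Finset.range n, A (i + 1) / (i + 1 : ℕ) * (1 / ((i : ℝ) + 2)) := by
    intro n
    induction n with
    | zero => simp
    | succ n ih =>
      rw [hstep (n + 1), ih, Finset.sum_range_succ]
      push_cast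
      field_simp
      ring
  set G : ℕ → ℝ := fun n => ∑ i ∈ Finset.range n, 1 / ((i : ℝ) + 2) with hG
  have hA1 : Tendsto (fun n : ℕ => A (n + 1) / (n + 1 : ℕ)) atTop (nhds c) :=
    hA.comp (tendsto_add_atTop_nat 1)
  have hharm : ∀ n : ℕ, (harmonic (n + 1) : ℝ) = G n + 1 := by
    intro n
    rw [harmonic, Finset.sum_range_succ', hG]
    push_cast
    simp only [one_div, zero_add, inv_one, add_left_inj]
    refine Finset.sum_congr rfl (fun i _ => ?_)
    congr 1
    ring
  have hlog : Tendsto (fun n : ℕ => (G n + 1) - Real.log (n + 1 : ℕ)) atTop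
      (nhds Real.eulerMascheroniConstant) := by
    have := Real.tendsto_harmonic_sub_log.comp (tendsto_add_atTop_nat 1)
    refine this.congr (fun n => ?_)
    simp only [Function.comp_apply, hharm]
  have hGtop : Tendsto G atTop atTop := by
    have h1 : Tendsto (fun n : ℕ => Real.log (n + 1 : ℕ)) atTop atTop :=
      Real.tendsto_log_atTop.comp (tendsto_natCast_atTop_atTop.comp (tendsto_add_atTop_nat 1))
    have h2 := (h1.atTop_add hlog)
    have h3 := tendsto_atTop_add_const_right _ (-1 : ℝ) h2
    refine h3.congr (fun n => ?_)
    ring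
  have hone : (fun _ : ℕ => (1 : ℝ)) =o[atTop] G := by
    rw [isLittleO_const_left]
    right
    exact tendsto_norm_atTop_atTop.comp hGtop
  have h1 : (fun n : ℕ => ∑ i ∈ Finset.range n,
      (A (i + 1) / (i + 1 : ℕ) - c) * (1 / ((i : ℝ) + 2))) =o[atTop] G := by
    refine IsLittleO.sum_range (g := fun i : ℕ => 1 / ((i : ℝ) + 2)) ?_ (fun i => by positivity) hGtop
    have : (fun n : ℕ => A (n + 1) / (n + 1 : ℕ) - c) =o[atTop] (fun _ : ℕ => (1 : ℝ)) := by
      rw [isLittleO_one_iff]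
      simpa using hA1.sub_const c
    simpa using this.mul_isBigO (isBigO_refl (fun i : ℕ => 1 / ((i : ℝ) + 2)) atTop)
  have h2 : (fun n : ℕ => A (n + 1) / (n + 1 : ℕ) + (T 1 - A 1)) =o[atTop] G :=
    ((hA1.add_const (T 1 - A 1)).isBigO_one ℝ).trans_isLittleO hone
  have h3 : (fun n : ℕ => T (n + 1) - κ * Real.log (n + 1 : ℕ)) =o[atTop] G := by
    refine IsBigO.trans_isLittleO ?_ hone
    refine IsBigO.of_bound C (Eventually.of_forall (fun n => ?_))
    rw [norm_one, mul_one]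
    exact hT (n + 1) (by omega)
  have h4 : (fun n : ℕ => κ * ((G n + 1) - Real.log (n + 1 : ℕ) - 1)) =o[atTop] G :=
    (((hlog.sub_const 1).const_mul κ).isBigO_one ℝ).trans_isLittleO hone
  have h5 : (fun n : ℕ => (κ - c) * G n) =o[atTop] G := by
    refine (((h1.add h2).sub h3).add h4).congr_left (fun n => ?_)
    rw [habel n]
    simp only [sub_mul, Finset.sum_sub_distrib, ← Finset.mul_sum]
    push_cast
    simp only [hG]
    ring
  by_contra hne
  have h6 : G =o[atTop] G := (isLittleO_const_mul_left_iff (sub_ne_zero.2 hne)).1 h5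
  exact isLittleO_irrefl (hGtop.eventually_ne_atTop 0).frequently h6

lemma finite_norm0 (n : ℕ) :
    {I : nonZeroDivisors (Ideal (𝓞 K)) | absNorm I.1 ≤ n}.Finite :=
  (Ideal.finite_setOfPred_absNorm_le (S := 𝓞 K) n).preimage Subtype.val_injective.injOn

/-- The finset of nonzero ideals of norm at most n. -/
def FN (n : ℕ) : Finset (nonZeroDivisors (Ideal (𝓞 K))) := (finite_norm0 K n).toFinset

lemma mem_FN {n : ℕ} {I : nonZeroDivisors (Ideal (𝓞 K))} : I ∈ FN K n ↔ absNorm I.1 ≤ n := by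
  simp [FN]

lemma kappa_eq (κ C : ℝ) (h : ∀ X : ℝ, 1 ≤ X →
    |(∑' a : {a : Ideal (𝓞 K) // a ≠ ⊥ ∧ (absNorm a : ℝ) ≤ X},
          ((absNorm a.1 : ℝ))⁻¹) - κ * Real.log X| ≤ C) :
    κ = (2 ^ (InfinitePlace.nrRealPlaces K) * (2 * Real.pi) ^ (InfinitePlace.nrComplexPlaces K) *
    NumberField.Units.regulator K * (NumberField.classNumber K)) /
  ((NumberField.Units.torsionOrder K : ℝ) * Real.sqrt |(NumberField.discr K : ℝ)|) := by
  classical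
  refine const_unique (fun n => (FN K n).card) (fun n => ∑ I ∈ FN K n, (absNorm I.1 : ℝ)⁻¹) κ _ C
    ?_ ?_ ?_
  · intro n
    have hu : FN K (n + 1) = FN K n ∪ (FN K (n + 1)).filter (fun I => absNorm I.1 = n + 1) := by
      ext I
      simp only [mem_FN, Finset.mem_union, Finset.mem_filter]
      omega
    have hd : Disjoint (FN K n) ((FN K (n + 1)).filter (fun I => absNorm I.1 = n + 1)) := by
      rw [Finset.disjoint_left]
      intro I hI hI'
      simp only [mem_FN, Finset.mem_filter] at hI hI'
      omega
    have hc := congrArg Finset.card hu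
    rw [Finset.card_union_of_disjoint hd] at hc
    rw [hc]
    conv_lhs => rw [hu, Finset.sum_union hd]
    congr 1
    rw [Finset.sum_congr rfl (g := fun _ => ((n : ℝ) + 1)⁻¹)]
    · rw [Finset.sum_const, nsmul_eq_mul]
      push_cast
      rw [add_sub_cancel_left, div_eq_mul_inv]
    · intro I hI
      rw [(Finset.mem_filter.1 hI).2]
      push_cast
      rfl
  · have := (NumberField.Ideal.tendsto_norm_le_div_atTop₀ K).comp tendsto_natCast_atTop_atTop
    refine this.congr (fun n => ?_)
    simp only [Function.comp_apply]
    congr 2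
    rw [← Nat.card_eq_finsetCard]
    refine Nat.card_congr (Equiv.subtypeEquivRight (fun I => ?_))
    rw [mem_FN, Nat.cast_le]
  · intro n hn
    have h1 := h n (by exact_mod_cast hn)
    convert h1 using 3
    rw [← Finset.tsum_subtype]
    let e : {I // I ∈ FN K n} ≃ {a : Ideal (𝓞 K) // a ≠ ⊥ ∧ (absNorm a : ℝ) ≤ (n : ℝ)} :=
      { toFun := fun I => ⟨I.1.1, nonZeroDivisors.coe_ne_zero I.1,
          by exact_mod_cast (mem_FN K).1 I.2⟩
        invFun := fun a => ⟨⟨a.1, mem_nonZeroDivisors_of_ne_zero a.2.1⟩,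
          (mem_FN K).2 (by exact_mod_cast a.2.2)⟩
        left_inv := fun _ => rfl
        right_inv := fun _ => rfl }
    exact e.tsum_eq (fun a : {a : Ideal (𝓞 K) // a ≠ ⊥ ∧ (absNorm a : ℝ) ≤ (n : ℝ)} =>
      ((absNorm a.1 : ℝ))⁻¹)

end Helpers

/-- `∑_{N(a) ≤ X} 1/N(a) = c_K log X + O(1)`. -/
theorem inverse_norm_sum :
    ∃ C : ℝ, 0 < C ∧ ∀ X : ℝ, 1 ≤ X →
      |(∑' a : {a : Ideal (𝓞 K) // a ≠ ⊥ ∧ (absNorm a : ℝ) ≤ X},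
          ((absNorm a.1 : ℝ))⁻¹) - cK K * Real.log X| ≤ C := by
  obtain ⟨κ, C, h⟩ := ideal_asymp K
  have hκ : κ = cK K := kappa_eq K κ C h
  subst hκ
  exact ⟨max C 1, lt_max_of_lt_right one_pos, fun X hX => (h X hX).trans (le_max_left _ _)⟩

end AlladiGen
end
end
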